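/- arXiv:2407.18167 — 16 statements merged into one kernel-verified Lean document; each statement's English description precedes it below -/
import Mathlib

section
/- Let G be a reflexive digraph such that the identity map is an isolated loop in Hom(G,G). If f : G^p → G is a surjective essentially unary polymorphism (p ≥ 1), then f is an isolated loop in Hom(G^p, G); that is, every homomorphism h : G^p → G admitting an arc h → f or f → h in Hom(G^p, G) equals f. -/
/-- A map is a digraph homomorphism if it sends arcs to arcs. -/
def IsHom {V W : Type*} (E : V → V → Prop) (F : W → W → Prop) (f : V → W) : Prop :=
  ∀ x y, E x y → F (f x) (f y)

/-- The arc relation of the `p`-th power digraph (componentwise arcs). -/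
def PowE {V : Type*} (E : V → V → Prop) (p : ℕ) : (Fin p → V) → (Fin p → V) → Prop :=
  fun x y => ∀ i, E (x i) (y i)

/-- A `p`-ary operation is essentially unary: it factors as a homomorphism applied
to one coordinate. -/
def EssUnary {V : Type*} (E : V → V → Prop) {p : ℕ} (f : (Fin p → V) → V) : Prop :=
  ∃ (i : Fin p) (g : V → V), IsHom E E g ∧ ∀ x, f x = g (x i)

/-- The arc relation of the digraph `Hom(G,H)`: `(f,g)` is an arc if `(f x, g y)` is an
arc of `H` whenever `(x,y)` is an arc of `G`. -/
def HomArc {V W : Type*} (E : V → V → Prop) (F : W → W → Prop) (f g : V → W) : Prop :=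
  ∀ x y, E x y → F (f x) (g y)

/-- A digraph is Słupecki if every surjective `k`-ary polymorphism (`k ≥ 2`) is
essentially unary. -/
def IsSlupecki {V : Type*} (E : V → V → Prop) : Prop :=
  ∀ k : ℕ, 2 ≤ k → ∀ f : (Fin k → V) → V,
    IsHom (PowE E k) E f → Function.Surjective f → EssUnary E f

/-- A digraph is idempotent trivial if every idempotent `p`-ary polymorphism (`p ≥ 2`)
is a projection. -/
def IdemTrivial {V : Type*} (E : V → V → Prop) : Prop :=
  ∀ p : ℕ, 2 ≤ p → ∀ f : (Fin p → V) → V, IsHom (PowE E p) E f →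
    (∀ x : V, f (fun _ => x) = x) → ∃ i : Fin p, ∀ x, f x = x i

/-- Directed reachability inside the digraph `Hom(G,H)` (all intermediate vertices are
homomorphisms). -/
def HomReach {V W : Type*} (E : V → V → Prop) (F : W → W → Prop) :
    (V → W) → (V → W) → Prop :=
  Relation.ReflTransGen (fun a b => IsHom E F a ∧ IsHom E F b ∧ HomArc E F a b)

/-- Reachability inside the symmetrization of the digraph `Hom(G,H)` (connected
components). -/
def HomSymReach {V W : Type*} (E : V → V → Prop) (F : W → W → Prop) :
    (V → W) → (V → W) → Prop :=
  Relation.ReflTransGen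
    (fun a b => IsHom E F a ∧ IsHom E F b ∧ (HomArc E F a b ∨ HomArc E F b a))

theorem IsHom.perm_pow {V : Type*} {E : V → V → Prop} {e : Equiv.Perm V} (he : IsHom E E e)
    (n : ℕ) : IsHom E E (e ^ n : Equiv.Perm V) := by
  induction n with
  | zero => exact fun x y hxy => by simpa using hxy
  | succ n ih => exact fun x y hxy => by simpa [pow_succ] using ih _ _ (he _ _ hxy)

/-- The inverse of a bijective endomorphism of a finite digraph is an endomorphism. -/
theorem IsHom.perm_symm {V : Type*} [Finite V] {E : V → V → Prop} {e : Equiv.Perm V}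
    (he : IsHom E E e) : IsHom E E e.symm := by
  have h : e.symm = e ^ (orderOf e - 1) := by
    refine inv_eq_of_mul_eq_one_left ?_
    rw [← pow_succ, Nat.sub_add_cancel (orderOf_pos e), pow_orderOf_eq_one]
  rw [h]
  exact he.perm_pow _

theorem PowE.update {V : Type*} {E : V → V → Prop} (hrefl : ∀ x, E x x) {p : ℕ}
    (a : Fin p → V) (i : Fin p) {y z : V} (hyz : E y z) :
    PowE E p (Function.update a i y) (Function.update a i z) := by
  intro j
  by_cases hj : j = i
  · subst hj; simpa using hyz
  · simpa [hj] using hrefl (a j)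

theorem stmt0 {V : Type*} [Fintype V] [Nonempty V] (E : V → V → Prop)
    (hrefl : ∀ x, E x x)
    (hid : ∀ h : V → V, IsHom E E h → (HomArc E E h id ∨ HomArc E E id h) → h = id)
    (p : ℕ) (hp : 1 ≤ p) (f : (Fin p → V) → V)
    (hf : IsHom (PowE E p) E f) (hsurj : Function.Surjective f) (hEU : EssUnary E f) :
    ∀ h : (Fin p → V) → V, IsHom (PowE E p) E h →
      (HomArc (PowE E p) E h f ∨ HomArc (PowE E p) E f h) → h = f := by
  classical
  obtain ⟨i, g, hg, hfg⟩ := hEU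
  have hgs : Function.Surjective g := fun v => (hsurj v).imp' (· i) fun x hx => by rw [← hx, hfg]
  obtain ⟨e, rfl⟩ : ∃ e : Equiv.Perm V, ⇑e = g :=
    ⟨Equiv.ofBijective g (Finite.surjective_iff_bijective.mp hgs), rfl⟩
  have hsymm := hg.perm_symm
  intro h hh harc
  funext a
  have key : (fun y => e.symm (h (Function.update a i y))) = id := by
    refine hid _ (fun y z hyz => hsymm _ _ (hh _ _ (PowE.update hrefl a i hyz))) ?_
    refine harc.imp (fun H y z hyz => ?_) (fun H y z hyz => ?_)
    · simpa [hfg] using hsymm _ _ (H _ _ (PowE.update hrefl a i hyz))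
    · simpa [hfg] using hsymm _ _ (H _ _ (PowE.update hrefl a i hyz))
  have ha := congrFun key (a i)
  simp only [Function.update_eq_self, id_eq, Equiv.symm_apply_eq] at ha
  rw [ha, hfg]
end

section
/- Let G be a reflexive digraph such that the identity is alone in its strong component of Hom(G,G). If f : G^n → G is a surjective essentially unary polymorphism, then f is alone in its strong component of Hom(G^n, G); that is, every homomorphism h : G^n → G lying in the same strong component of Hom(G^n, G) as f equals f. -/
theorem IsHom.comp {U V W : Type*} {D : U → U → Prop} {E : V → V → Prop} {F : W → W → Prop}
    {g : V → W} {f : U → V} (hg : IsHom E F g) (hf : IsHom D E f) : IsHom D F (g ∘ f) :=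
  fun x y hxy => hg _ _ (hf x y hxy)

theorem IsHom.iterate {V : Type*} {E : V → V → Prop} {g : V → V} (hg : IsHom E E g) (m : ℕ) :
    IsHom E E g^[m] := by
  induction m with
  | zero => exact fun _ _ h => h
  | succ m ih => exact ih.comp hg

/-- A surjective endomorphism of a finite digraph has a left inverse endomorphism. -/
theorem IsHom.exists_leftInverse {V : Type*} [Finite V] {E : V → V → Prop} {g : V → V}
    (hg : IsHom E E g) (hs : Function.Surjective g) :
    ∃ g' : V → V, IsHom E E g' ∧ Function.LeftInverse g' g := by
  obtain ⟨σ, rfl⟩ : ∃ σ : Equiv.Perm V, σ = g :=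
    ⟨Equiv.ofBijective g ⟨Finite.injective_iff_surjective.mpr hs, hs⟩, rfl⟩
  obtain ⟨m, hm, hσ⟩ := (isOfFinOrder_of_finite σ).exists_pow_eq_one
  obtain ⟨k, rfl⟩ := Nat.exists_eq_succ_of_ne_zero hm.ne'
  refine ⟨σ^[k], hg.iterate k, fun x => ?_⟩
  have h := congrArg (fun τ : Equiv.Perm V => τ x) hσ
  simpa [Equiv.Perm.coe_pow] using h

/-- Composing on both sides with homomorphisms preserves reachability between homomorphisms. -/
theorem HomReach.comp {T U V W : Type*} {C : T → T → Prop} {D : U → U → Prop}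
    {E : V → V → Prop} {F : W → W → Prop} {g : V → W} {r : T → U}
    (hg : IsHom E F g) (hr : IsHom C D r) {a b : U → V} (h : HomReach D E a b) :
    HomReach C F (g ∘ a ∘ r) (g ∘ b ∘ r) :=
  Relation.ReflTransGen.lift (fun k : U → V => g ∘ k ∘ r)
    (fun _ _ ⟨ha, hb, hab⟩ => ⟨hg.comp (ha.comp hr), hg.comp (hb.comp hr),
      fun x y hxy => hg _ _ (hab _ _ (hr x y hxy))⟩) _ _ h

theorem isHom_update {V : Type*} {E : V → V → Prop} (hrefl : ∀ x, E x x) {n : ℕ}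
    (a : Fin n → V) (i : Fin n) : IsHom E (PowE E n) (Function.update a i) := by
  intro x y hxy j
  by_cases hj : j = i
  · subst hj
    simpa using hxy
  · simpa [hj] using hrefl (a j)

theorem stmt2 {V : Type*} [Fintype V] [Nonempty V] (E : V → V → Prop)
    (hrefl : ∀ x, E x x)
    (hid : ∀ h : V → V, IsHom E E h → HomReach E E id h → HomReach E E h id → h = id)
    (n : ℕ) (f : (Fin n → V) → V)
    (hf : IsHom (PowE E n) E f) (hsurj : Function.Surjective f) (hEU : EssUnary E f) :
    ∀ h : (Fin n → V) → V, IsHom (PowE E n) E h →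
      HomReach (PowE E n) E f h → HomReach (PowE E n) E h f → h = f := by
  intro h hh hfh hhf
  obtain ⟨i, g, hg, hfg⟩ := hEU
  have hgs : Function.Surjective g := fun y => by
    obtain ⟨x, hx⟩ := hsurj y
    exact ⟨x i, by rw [← hfg, hx]⟩
  obtain ⟨g', hg', hinv⟩ := hg.exists_leftInverse hgs
  have hinj : Function.Injective g' :=
    Finite.injective_iff_surjective.mpr hinv.surjective
  funext a
  have hr := isHom_update hrefl a i
  have hid' : g' ∘ f ∘ Function.update a i = id := by
    funext x
    simp [hfg, hinv x]
  have key := hid (g' ∘ h ∘ Function.update a i) (hg'.comp (hh.comp hr))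
    (hid' ▸ hfh.comp hg' hr) (hid' ▸ hhf.comp hg' hr)
  have hpt := congrFun (key.trans hid'.symm) (a i)
  simp only [Function.comp_apply, Function.update_eq_self] at hpt
  exact hinj hpt
end

section
/- Let G be a strongly connected, idempotent trivial reflexive digraph such that the identity is alone in its strong component of Hom(G,G), and let f : G^n → G (n ≥ 2) be a surjective polymorphism. If there exists an embedding e : G ↪ G^n such that the restriction of f to the image e(G) is surjective onto G, then f is essentially unary. -/
/-- The inverse of a bijective endomorphism of a finite digraph is an endomorphism. -/
theorem IsHom.symm_of_finite {V : Type*} [Finite V] {E : V → V → Prop} (σ : Equiv.Perm V)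
    (hσ : IsHom E E σ) : IsHom E E σ.symm := by
  have hpow : ∀ k : ℕ, IsHom E E (σ ^ k : Equiv.Perm V) := by
    intro k
    induction k with
    | zero => intro x y hxy; simpa using hxy
    | succ k ih =>
      intro x y hxy
      simpa [pow_succ] using ih _ _ (hσ _ _ hxy)
  have hinv : σ ^ (orderOf σ - 1) = σ⁻¹ := by
    apply eq_inv_of_mul_eq_one_left
    rw [← pow_succ, Nat.sub_add_cancel (orderOf_pos σ), pow_orderOf_eq_one]
  have h := hpow (orderOf σ - 1)
  rw [hinv] at h
  exact h

/-- Finite powers of a strongly connected reflexive digraph are strongly connected. -/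
theorem reflTransGen_powE {V : Type*} {E : V → V → Prop} (hrefl : ∀ x, E x x)
    (hsc : ∀ x y : V, Relation.ReflTransGen E x y) {n : ℕ} (w w' : Fin n → V) :
    Relation.ReflTransGen (PowE E n) w w' := by
  have hstep : ∀ (u : Fin n → V) (j : Fin n) (b : V),
      Relation.ReflTransGen (PowE E n) u (Function.update u j b) := by
    intro u j b
    have h := (hsc (u j) b).lift (r := E) (p := PowE E n) (fun c => Function.update u j c) (by
      intro c d hcd k
      by_cases hk : k = j
      · subst hk; simpa using hcd
      · simpa [hk] using hrefl (u k))
    simpa [Function.onFun] using h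
  have hs : ∀ s : Finset (Fin n), Relation.ReflTransGen (PowE E n) w (s.piecewise w' w) := by
    intro s
    induction s using Finset.induction_on with
    | empty => simpa using Relation.ReflTransGen.refl
    | insert j s _ ih =>
      rw [Finset.piecewise_insert]
      exact ih.trans (hstep _ _ _)
  simpa using hs Finset.univ

theorem stmt3 {V : Type*} [Fintype V] [Nonempty V] (E : V → V → Prop)
    (hrefl : ∀ x, E x x)
    (hsc : ∀ x y : V, Relation.ReflTransGen E x y)
    (hIT : IdemTrivial E)
    (hid : ∀ h : V → V, IsHom E E h → HomReach E E id h → HomReach E E h id → h = id)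
    (n : ℕ) (hn : 2 ≤ n) (f : (Fin n → V) → V)
    (hf : IsHom (PowE E n) E f) (hsurj : Function.Surjective f)
    (e : V → Fin n → V) (hinj : Function.Injective e)
    (hemb : ∀ x y, PowE E n (e x) (e y) ↔ E x y)
    (hres : ∀ z : V, ∃ x : V, f (e x) = z) :
    EssUnary E f := by
  classical
  have heHom : IsHom E (PowE E n) e := fun x y h => (hemb x y).2 h
  -- After precomposing `e` with an automorphism, `f ∘ e` is the identity.
  let σ : Equiv.Perm V := Equiv.ofBijective (fun x => f (e x))
    (Finite.surjective_iff_bijective.1 hres)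
  have hσ : IsHom E E σ := fun x y h => hf _ _ (heHom _ _ h)
  have hσ' := IsHom.symm_of_finite σ hσ
  let e' : V → Fin n → V := fun x => e (σ.symm x)
  have he' : IsHom E (PowE E n) e' := fun x y h => heHom _ _ (hσ' _ _ h)
  have hfe : ∀ x, f (e' x) = x := fun x => σ.apply_symm_apply x
  obtain ⟨i, hi⟩ := hIT n hn (fun x => f (fun j => e' (x j) j))
    (fun x y h => hf _ _ fun j => he' _ _ (h j) j) hfe
  have hinj' : Function.Injective (fun x => e' x i) := by
    intro x y hxy
    obtain ⟨v⟩ := ‹Nonempty V›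
    have hx := hi (Function.update (fun _ => v) i x)
    have hy := hi (Function.update (fun _ => v) i y)
    simp only [Function.update_self] at hx hy
    rw [← hx, ← hy]
    congr 1
    funext j
    by_cases hj : j = i
    · subst hj; simpa using hxy
    · simp [hj]
  let a : Equiv.Perm V := Equiv.ofBijective (fun x => e' x i)
    (Finite.injective_iff_bijective.1 hinj')
  have ha : IsHom E E a := fun x y h => he' x y h i
  -- The unary maps obtained by fixing all coordinates but `i` lie in one strong component.
  let φ : (Fin n → V) → V → V := fun w x => f (Function.update w i (a x))
  have hφarc : ∀ w w', PowE E n w w' → HomArc E E (φ w) (φ w') := by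
    intro w w' hw x y hxy
    refine hf _ _ fun j => ?_
    by_cases hj : j = i
    · subst hj; simpa using ha _ _ hxy
    · simpa [hj] using hw j
  have hφ : ∀ w, IsHom E E (φ w) := fun w => hφarc w w fun j => hrefl _
  have hreach : ∀ w w', HomReach E E (φ w) (φ w') := fun w w' =>
    (reflTransGen_powE hrefl hsc w w').lift φ
      fun u u' h => ⟨hφ u, hφ u', hφarc u u' h⟩
  obtain ⟨v⟩ := ‹Nonempty V›
  have hφid : φ (e' v) = id := by
    funext x
    have hx := hi (Function.update (fun _ => v) i x)
    simp only [Function.update_self] at hx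
    refine Eq.trans ?_ hx
    change f _ = f _
    congr 1
    funext j
    by_cases hj : j = i
    · subst hj; simp [a]
    · simp [hj]
  refine ⟨i, a.symm, IsHom.symm_of_finite a ha, fun w => ?_⟩
  have hw : φ w = id := hid _ (hφ w) (hφid ▸ hreach _ _) (hφid ▸ hreach _ _)
  have := congrFun hw (a.symm (w i))
  simpa [φ] using this
end

section
/- Let G be a finite poset, regarded as a reflexive digraph via its order relation. If G is idempotent trivial, then the identity is an isolated loop in Hom(G,G). -/
open Classical in
/-- If every element strictly above `a` lies above some `b > a`, the order on `V` is not
idempotent trivial: pushing the first coordinate from `a` to `b` whenever the second is not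
below `a` is a nontrivial idempotent polymorphism. -/
lemma not_idemTrivial_of_forall_lt_le {V : Type*} [PartialOrder V] {a b : V} (hab : a < b)
    (hb : ∀ y, a < y → b ≤ y) : ¬ IdemTrivial (fun x y : V => x ≤ y) := by
  intro hIT
  let f : (Fin 2 → V) → V := fun x => if x 0 = a then (if x 1 ≤ a then a else b) else x 0
  have hf : IsHom (PowE (fun x y : V => x ≤ y) 2) (fun x y : V => x ≤ y) f := by
    intro x y hxy
    have h0 : x 0 ≤ y 0 := hxy 0
    have h1 : x 1 ≤ y 1 := hxy 1
    change (if x 0 = a then (if x 1 ≤ a then a else b) else x 0) ≤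
      (if y 0 = a then (if y 1 ≤ a then a else b) else y 0)
    split_ifs with hx hx1 hy hy1 hy hy1 hy hy1
    · exact le_rfl
    · exact hab.le
    · exact hx ▸ h0
    · exact absurd (h1.trans hy1) hx1
    · exact le_rfl
    · exact hb _ (lt_of_le_of_ne (hx ▸ h0) (Ne.symm hy))
    · exact hy ▸ h0
    · exact (hy ▸ h0 : x 0 ≤ a).trans hab.le
    · exact h0
  obtain ⟨i, hi⟩ := hIT 2 le_rfl f hf (by intro x; by_cases hx : x = a <;> simp [f, hx])
  have h1 := hi ![a, b]
  have h2 := hi ![b, a]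
  fin_cases i
  · simp [f, hab.not_ge, hab.ne'] at h1
  · simp [f, hab.ne'] at h2

/-- A monotone self-map of a finite idempotent trivial poset lying above the identity is the
identity. -/
lemma IdemTrivial.eq_id_of_forall_le {V : Type*} [Finite V] [PartialOrder V]
    (hIT : IdemTrivial (fun x y : V => x ≤ y)) {h : V → V} (hm : Monotone h)
    (hle : ∀ x, x ≤ h x) : h = id := by
  by_contra hne
  obtain ⟨x, hx⟩ := Function.ne_iff.mp hne
  obtain ⟨a, ha⟩ := (Set.toFinite {x | h x ≠ x}).exists_maximal ⟨x, hx⟩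
  refine not_idemTrivial_of_forall_lt_le (lt_of_le_of_ne (hle a) (Ne.symm ha.prop)) ?_ hIT
  intro y hy
  have hfix : h y = y := by
    by_contra hmoved
    exact ha.not_prop_of_gt hy hmoved
  exact hfix ▸ hm hy.le

theorem stmt4 {V : Type*} [Fintype V] [Nonempty V] [PartialOrder V]
    (hIT : IdemTrivial (fun x y : V => x ≤ y)) :
    ∀ h : V → V, IsHom (fun x y : V => x ≤ y) (fun x y : V => x ≤ y) h →
      (HomArc (fun x y : V => x ≤ y) (fun x y : V => x ≤ y) h id ∨
        HomArc (fun x y : V => x ≤ y) (fun x y : V => x ≤ y) id h) → h = id := by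
  rintro h hh (hle | hle)
  · exact IdemTrivial.eq_id_of_forall_le (V := Vᵒᵈ)
      (fun p hp f hf => hIT p hp f fun x y hxy => hf y x hxy)
      (h := h) (fun x y hxy => hh y x hxy) (fun x => hle x x le_rfl)
  · exact hIT.eq_id_of_forall_le (fun x y hxy => hh x y hxy) (fun x => hle x x le_rfl)
end

section
/- Let G be a reflexive symmetric digraph (whenever (x,y) is an arc, so is (y,x)). If G is idempotent trivial, then the identity is an isolated loop in Hom(G,G). -/
open scoped Classical in
/-- If `h` is adjacent to the identity in `Hom(G,G)`, then any operation whose value at `x`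
is `x 0` or `h (x 0)` is a polymorphism; we use `h` exactly off the diagonal. -/
noncomputable def offDiag {V : Type*} (h : V → V) (x : Fin 3 → V) : V :=
  if ∀ i, x i = x 0 then x 0 else h (x 0)

theorem offDiag_isHom {V : Type*} {E : V → V → Prop} (hsym : ∀ x y, E x y → E y x)
    {h : V → V} (hh : IsHom E E h) (hid : HomArc E E h id) :
    IsHom (PowE E 3) E (offDiag h) := by
  intro x y hxy
  have h0 := hxy 0
  unfold offDiag
  split_ifs
  · exact h0
  · exact hsym _ _ (hid _ _ (hsym _ _ h0))
  · exact hid _ _ h0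
  · exact hh _ _ h0

theorem offDiag_const {V : Type*} (h : V → V) (x : V) : offDiag h (fun _ => x) = x := by
  simp [offDiag]

theorem eq_self_of_offDiag_eq_proj {V : Type*} {h : V → V} {i : Fin 3}
    (hi : ∀ x, offDiag h x = x i) {a b : V} (hab : b ≠ a) : h a = a := by
  obtain ⟨j, hj0, hji⟩ : ∃ j : Fin 3, j ≠ 0 ∧ j ≠ i := by
    clear hi
    revert i
    decide
  have key := hi (Function.update (fun _ => a) j b)
  have hne : ¬ ∀ k, Function.update (fun _ : Fin 3 => a) j b k =
      Function.update (fun _ : Fin 3 => a) j b 0 := by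
    intro H
    have := H j
    rw [Function.update_self, Function.update_of_ne hj0.symm] at this
    exact hab this
  rwa [offDiag, if_neg hne, Function.update_of_ne hj0.symm,
    Function.update_of_ne hji.symm] at key

theorem stmt5 {V : Type*} [Fintype V] [Nonempty V] (E : V → V → Prop)
    (hrefl : ∀ x, E x x)
    (hsym : ∀ x y, E x y → E y x)
    (hIT : IdemTrivial E) :
    ∀ h : V → V, IsHom E E h → (HomArc E E h id ∨ HomArc E E id h) → h = id := by
  intro h hh harc
  have hid : HomArc E E h id := by
    rcases harc with H | H
    · exact H
    · exact fun x y hxy => hsym _ _ (H y x (hsym _ _ hxy))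
  obtain ⟨i, hi⟩ := hIT 3 (by norm_num) (offDiag h) (offDiag_isHom hsym hh hid)
    (offDiag_const h)
  funext a
  by_contra hne
  exact hne (eq_self_of_offDiag_eq_proj hi hne)
end

section
/- Let G be a reflexive intransitive digraph, i.e. there are no three pairwise distinct vertices x, y, z with arcs x → y, y → z and x → z. If G is idempotent trivial, then the identity is an isolated loop in Hom(G,G). -/
/-- A reflexive digraph with a vertex `y` whose only neighbour is `z`, with `y → z`, is not
idempotent trivial. -/
theorem not_idemTrivial_of_pendant {V : Type*} {E : V → V → Prop} (hrefl : ∀ x, E x x) {y z : V}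
    (hyz : y ≠ z) (hE : E y z) (hout : ∀ x, E y x → x = y ∨ x = z)
    (hin : ∀ x, E x y → x = y ∨ x = z) : ¬ IdemTrivial E := by
  classical
  intro hIT
  obtain ⟨i, hi⟩ := hIT 2 le_rfl (fun v => if v 0 = y ∧ v 1 ≠ y then z else v 0)
    (by
      intro v w hvw
      have h0 := hvw 0
      have h1 := hvw 1
      dsimp only
      generalize v 0 = a, v 1 = b, w 0 = c, w 1 = d at *
      grind)
    (by intro x; simp)
  have h₁ := hi ![y, z]
  have h₂ := hi ![z, y]
  fin_cases i <;> simp_all [hyz.symm]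

/-- In an idempotent trivial reflexive intransitive digraph, the only homomorphism `h` with an
arc `id → h` is the identity. -/
theorem eq_id_of_homArc_id {V : Type*} {E : V → V → Prop} (hrefl : ∀ x, E x x)
    (hintr : ¬ ∃ x y z : V, x ≠ y ∧ y ≠ z ∧ x ≠ z ∧ E x y ∧ E y z ∧ E x z)
    (hIT : IdemTrivial E) {h : V → V} (hh : IsHom E E h) (hid : HomArc E E id h) : h = id := by
  have hin : ∀ x y, h y ≠ y → E x y → x = y ∨ x = h y := by
    intro x y hy hxy
    by_contra! hne
    exact hintr ⟨x, y, h y, hne.1, hy.symm, hne.2, hxy, hid y y (hrefl y), hid x y hxy⟩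
  by_contra hne
  obtain ⟨y, hy⟩ := Function.ne_iff.1 hne
  refine not_idemTrivial_of_pendant hrefl (Ne.symm hy) (hid y y (hrefl y)) ?_
    (fun x => hin x y hy) hIT
  intro z hyz
  by_contra! hz
  by_cases hfix : h z = z
  · have hhz := hh y z hyz
    rw [hfix] at hhz
    exact hintr ⟨y, h y, z, Ne.symm hy, hz.2.symm, hz.1.symm, hid y y (hrefl y), hhz, hyz⟩
  · rcases hin y z hfix hyz with e | e
    · exact hz.1 e.symm
    · have hzy := hid z z (hrefl z)
      rw [← e] at hzy
      rcases hin z y hy hzy with e' | e'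
      exacts [hz.1 e', hz.2 e']

/-- Idempotent triviality passes to the opposite digraph. -/
theorem IdemTrivial.flip {V : Type*} {E : V → V → Prop} (hIT : IdemTrivial E) :
    IdemTrivial (flip E) :=
  fun p hp f hf => hIT p hp f fun x y hxy => hf y x hxy

theorem stmt6 {V : Type*} [Fintype V] [Nonempty V] (E : V → V → Prop)
    (hrefl : ∀ x, E x x)
    (hintr : ¬ ∃ x y z : V, x ≠ y ∧ y ≠ z ∧ x ≠ z ∧ E x y ∧ E y z ∧ E x z)
    (hIT : IdemTrivial E) :
    ∀ h : V → V, IsHom E E h → (HomArc E E h id ∨ HomArc E E id h) → h = id := by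
  rintro h hh (hid | hid)
  · refine eq_id_of_homArc_id (E := flip E) hrefl ?_ hIT.flip (fun x y hxy => hh y x hxy)
      fun x y hxy => hid y x hxy
    rintro ⟨x, y, z, hxy, hyz, hxz, h₁, h₂, h₃⟩
    exact hintr ⟨z, y, x, hyz.symm, hxy.symm, hxz.symm, h₂, h₁, h₃⟩
  · exact eq_id_of_homArc_id hrefl hintr hIT hh hid
end

section
/- Let G be a Słupecki reflexive digraph which is not strongly connected. Then the identity is alone in its connected component of Hom(G,G): every homomorphism f : G → G lying in the same connected component of Hom(G,G) as the identity (with respect to the symmetrization of the arc relation of Hom(G,G)) equals the identity. -/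
/-- If `(p, q)` is an arc of `Hom(G,G)` and `S` is closed under out-neighbours, then applying `q`
to the first argument when the second lies in `S`, and `p` otherwise, is a polymorphism. -/
theorem isHom_ite_of_homArc {V : Type*} {E : V → V → Prop} {p q : V → V} (hp : IsHom E E p)
    (hq : IsHom E E q) (hpq : HomArc E E p q) {S : V → Prop} [DecidablePred S]
    (hS : ∀ x y, E x y → S x → S y) :
    IsHom (PowE E 2) E (fun x => if S (x 1) then q (x 0) else p (x 0)) := by
  intro x y hxy
  by_cases hx : S (x 1)
  · simpa only [if_pos hx, if_pos (hS _ _ (hxy 1) hx)] using hq _ _ (hxy 0)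
  · by_cases hy : S (y 1)
    · simpa only [if_neg hx, if_pos hy] using hpq _ _ (hxy 0)
    · simpa only [if_neg hx, if_neg hy] using hp _ _ (hxy 0)

/-- In a Słupecki digraph that is not strongly connected, the ends of an arc of `Hom(G,G)` coincide
as soon as one of them is surjective and one is injective. -/
theorem IsSlupecki.eq_of_homArc {V : Type*} {E : V → V → Prop} (hS : IsSlupecki E)
    (hnsc : ¬ ∀ x y : V, Relation.ReflTransGen E x y) {p q : V → V} (hp : IsHom E E p)
    (hq : IsHom E E q) (hpq : HomArc E E p q)
    (hsurj : Function.Surjective p ∨ Function.Surjective q)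
    (hinj : Function.Injective p ∨ Function.Injective q) : p = q := by
  classical
  push Not at hnsc
  obtain ⟨a, b, hab⟩ := hnsc
  have hne : a ≠ b := by
    rintro rfl
    exact hab .refl
  obtain ⟨i, g, -, hg⟩ := hS 2 le_rfl _
    (isHom_ite_of_homArc hp hq hpq (S := Relation.ReflTransGen E a)
      fun x y hxy hx => hx.tail hxy) (by
        intro z
        rcases hsurj with h | h
        · obtain ⟨x, hx⟩ := h z
          exact ⟨![x, b], by simpa [hab] using hx⟩
        · obtain ⟨x, hx⟩ := h z
          exact ⟨![x, a], by simpa [Relation.ReflTransGen.refl] using hx⟩)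
  have hpg : ∀ x, p x = g (![x, b] i) := fun x => by simpa [hab] using hg ![x, b]
  have hqg : ∀ x, q x = g (![x, a] i) := fun x => by
    simpa [Relation.ReflTransGen.refl] using hg ![x, a]
  fin_cases i
  · funext x
    simpa using (hpg x).trans (hqg x).symm
  · refine absurd ?_ hne
    rcases hinj with h | h
    · exact h (by simp [hpg])
    · exact h (by simp [hqg])

theorem stmt7 {V : Type*} [Fintype V] [Nonempty V] (E : V → V → Prop)
    (hrefl : ∀ x, E x x)
    (hS : IsSlupecki E)
    (hnsc : ¬ ∀ x y : V, Relation.ReflTransGen E x y) :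
    ∀ h : V → V, IsHom E E h → HomSymReach E E id h → h = id := by
  intro h _ hr
  induction hr with
  | refl => rfl
  | tail _ hbc ih =>
    obtain ⟨hb, hc, harc⟩ := hbc
    obtain rfl := ih hb
    rcases harc with harc | harc
    · exact (hS.eq_of_homArc hnsc hb hc harc (.inl Function.surjective_id)
        (.inl Function.injective_id)).symm
    · exact hS.eq_of_homArc hnsc hc hb harc (.inr Function.surjective_id)
        (.inr Function.injective_id)
end

section
/- Let G be the reflexive digraph on vertices {0,1,2,3} whose arcs are all loops together with (0,1), (1,2), (2,3), (3,0), (3,1). Then: (a) G is Słupecki; (b) G is strongly connected; (c) letting r : G → G be the retraction fixing 1, 2, 3 and sending 0 to 1, and s : G → G be the retraction fixing 1, 2, 3 and sending 0 to 3, there are arcs s → id and id → r in Hom(G,G), so the identity is not an isolated loop in Hom(G,G); and (d) the connected component of the identity in Hom(G,G) is exactly {id, r, s}, so in particular the identity is alone in its strong component of Hom(G,G). -/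
/-- The digraph of Lemma 3.8: vertices `{0,1,2,3}`, arcs the loops together with
`(0,1), (1,2), (2,3), (3,0), (3,1)`. -/
def E8 : Fin 4 → Fin 4 → Prop := fun x y =>
  x = y ∨ (x, y) ∈ ({(0,1), (1,2), (2,3), (3,0), (3,1)} : Set (Fin 4 × Fin 4))

/-- The retraction fixing `1, 2, 3` and sending `0` to `1`. -/
def r8 : Fin 4 → Fin 4 := ![1, 1, 2, 3]

/-- The retraction fixing `1, 2, 3` and sending `0` to `3`. -/
def s8 : Fin 4 → Fin 4 := ![3, 1, 2, 3]

instance decidableRelE8 : DecidableRel E8 := fun x y =>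
  decidable_of_iff
    (x = y ∨ (x, y) = (0, 1) ∨ (x, y) = (1, 2) ∨ (x, y) = (2, 3) ∨ (x, y) = (3, 0) ∨
      (x, y) = (3, 1)) Iff.rfl

instance decidableIsHomE8 (g : Fin 4 → Fin 4) : Decidable (IsHom E8 E8 g) :=
  inferInstanceAs (Decidable (∀ x y, E8 x y → E8 (g x) (g y)))

instance decidableHomArcE8 (g h : Fin 4 → Fin 4) : Decidable (HomArc E8 E8 g h) :=
  inferInstanceAs (Decidable (∀ x y, E8 x y → E8 (g x) (h y)))

lemma E8_refl (x : Fin 4) : E8 x x := Or.inl rfl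

/-- Any two vertices are joined by a directed walk of length three. -/
lemma E8_walk_three : ∀ x y : Fin 4, ∃ u v, E8 x u ∧ E8 u v ∧ E8 v y := by decide

lemma powE_E8_reach {k : ℕ} (x y : Fin k → Fin 4) :
    Relation.ReflTransGen (PowE E8 k) x y := by
  choose u v hu huv hv using fun i => E8_walk_three (x i) (y i)
  exact ((Relation.ReflTransGen.single (r := PowE E8 k) hu).tail huv).tail hv

lemma E8_reach (x y : Fin 4) : Relation.ReflTransGen E8 x y := by
  obtain ⟨u, v, hu, huv, hv⟩ := E8_walk_three x y
  exact ((Relation.ReflTransGen.single hu).tail huv).tail hv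

/-- An endomorphism identifying `1` and `3` is constant. -/
lemma endo_constant_of_eq : ∀ g : Fin 4 → Fin 4, IsHom E8 E8 g → g 1 = g 3 →
    ∀ t u, g t = g u := by decide +kernel

/-- Endomorphisms that are nonconstant on the triangle are not adjacent to constant ones. -/
lemma endo_ne_of_homArc : ∀ g : Fin 4 → Fin 4, IsHom E8 E8 g → g 1 ≠ g 3 →
    ∀ h, IsHom E8 E8 h → HomArc E8 E8 g h → h 1 ≠ h 3 := by decide +kernel

/-- The only nonconstant endomorphism attaining the value `0` is the identity. -/
lemma endo_eq_id_of_apply_eq_zero : ∀ g : Fin 4 → Fin 4, IsHom E8 E8 g → g 1 ≠ g 3 →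
    ∀ t, g t = 0 → g = id := by decide +kernel

lemma eq_of_homArc_id : ∀ h : Fin 4 → Fin 4, IsHom E8 E8 h → HomArc E8 E8 id h →
    h = id ∨ h = r8 := by decide +kernel

lemma eq_of_homArc_r8 : ∀ h : Fin 4 → Fin 4, IsHom E8 E8 h → HomArc E8 E8 r8 h →
    h = r8 := by decide +kernel

lemma adjacent_closed : ∀ g : Fin 4 → Fin 4, g = id ∨ g = r8 ∨ g = s8 →
    ∀ h, IsHom E8 E8 h → HomArc E8 E8 g h ∨ HomArc E8 E8 h g →
      h = id ∨ h = r8 ∨ h = s8 := by decide +kernel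

lemma isHom_r8 : IsHom E8 E8 r8 := by decide

lemma isHom_s8 : IsHom E8 E8 s8 := by decide

lemma isHom_id_E8 : IsHom E8 E8 id := fun _ _ h => h

lemma homArc_s8_id : HomArc E8 E8 s8 id := by decide

lemma homArc_id_r8 : HomArc E8 E8 id r8 := by decide

lemma eq_r8_of_homReach {h : Fin 4 → Fin 4} (hr : HomReach E8 E8 r8 h) : h = r8 := by
  induction hr with
  | refl => rfl
  | tail _ hbc ih =>
    subst ih
    exact eq_of_homArc_r8 _ hbc.2.1 hbc.2.2

lemma eq_id_or_r8_of_homReach {h : Fin 4 → Fin 4} (hr : HomReach E8 E8 id h) :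
    h = id ∨ h = r8 := by
  induction hr with
  | refl => exact Or.inl rfl
  | tail _ hbc ih =>
    rcases ih with rfl | rfl
    · exact eq_of_homArc_id _ hbc.2.1 hbc.2.2
    · exact Or.inr (eq_of_homArc_r8 _ hbc.2.1 hbc.2.2)

/-- The identity is alone in its strong component of `Hom(G,G)`. -/
lemma eq_id_of_homReach {h : Fin 4 → Fin 4} (h₁ : HomReach E8 E8 id h)
    (h₂ : HomReach E8 E8 h id) : h = id := by
  rcases eq_id_or_r8_of_homReach h₁ with rfl | rfl
  · rfl
  · exact (eq_r8_of_homReach h₂).symm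

lemma homSymReach_id_iff {h : Fin 4 → Fin 4} :
    HomSymReach E8 E8 id h ↔ h = id ∨ h = r8 ∨ h = s8 := by
  constructor
  · intro hr
    induction hr with
    | refl => exact Or.inl rfl
    | tail _ hbc ih => exact adjacent_closed _ ih _ hbc.2.1 hbc.2.2
  · rintro (rfl | rfl | rfl)
    · exact .refl
    · exact .single ⟨isHom_id_E8, isHom_r8, Or.inl homArc_id_r8⟩
    · exact .single ⟨isHom_id_E8, isHom_s8, Or.inr homArc_s8_id⟩

/-- Restricting a polymorphism to the lines in direction `i` maps arcs of the power to arcs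
of `Hom(G,G)`. -/
lemma homArc_line {k : ℕ} {f : (Fin k → Fin 4) → Fin 4} (hf : IsHom (PowE E8 k) E8 f)
    (i : Fin k) {x y : Fin k → Fin 4} (hxy : PowE E8 k x y) :
    HomArc E8 E8 (fun t => f (Function.update x i t)) (fun t => f (Function.update y i t)) := by
  intro s t hst
  refine hf _ _ fun j => ?_
  by_cases hj : j = i
  · subst hj
    simpa using hst
  · simpa [hj] using hxy j

lemma isHom_line {k : ℕ} {f : (Fin k → Fin 4) → Fin 4} (hf : IsHom (PowE E8 k) E8 f)
    (i : Fin k) (x : Fin k → Fin 4) : IsHom E8 E8 (fun t => f (Function.update x i t)) :=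
  homArc_line hf i fun j => E8_refl (x j)

lemma homReach_line {k : ℕ} {f : (Fin k → Fin 4) → Fin 4} (hf : IsHom (PowE E8 k) E8 f)
    (i : Fin k) (x y : Fin k → Fin 4) :
    HomReach E8 E8 (fun t => f (Function.update x i t))
      (fun t => f (Function.update y i t)) :=
  (powE_E8_reach x y).lift (fun z t => f (Function.update z i t)) fun a b hab =>
    ⟨isHom_line hf i a, isHom_line hf i b, homArc_line hf i hab⟩

lemma ne_of_homReach {g h : Fin 4 → Fin 4} (hr : HomReach E8 E8 g h) (hg : g 1 ≠ g 3) :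
    h 1 ≠ h 3 := by
  induction hr with
  | refl => exact hg
  | tail _ hbc ih => exact endo_ne_of_homArc _ hbc.1 ih _ hbc.2.1 hbc.2.2

/-- An operation that does not change when one coordinate is updated is constant. -/
lemma eq_of_update_eq {ι α β : Type*} [Fintype ι] [DecidableEq ι] {f : (ι → α) → β}
    (hf : ∀ x i t, f (Function.update x i t) = f x) (x y : ι → α) : f x = f y := by
  have key : ∀ s : Finset ι, f (s.piecewise x y) = f y := by
    intro s
    induction s using Finset.induction_on with
    | empty => simp
    | insert j s _ ih => rw [Finset.piecewise_insert, hf, ih]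
  simpa using key Finset.univ

lemma isSlupecki_E8 : IsSlupecki E8 := by
  intro k _ f hf hsurj
  by_cases H : ∃ (i : Fin k) (x : Fin k → Fin 4),
      f (Function.update x i 1) ≠ f (Function.update x i 3)
  · obtain ⟨i, x, hx⟩ := H
    obtain ⟨z, hz⟩ := hsurj 0
    have hz_id : (fun t => f (Function.update z i t)) = id :=
      endo_eq_id_of_apply_eq_zero _ (isHom_line hf i z)
        (ne_of_homReach (homReach_line hf i x z) hx) (z i) (by simpa using hz)
    refine ⟨i, id, isHom_id_E8, fun y => ?_⟩
    have hy : (fun t => f (Function.update y i t)) = id :=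
      eq_id_of_homReach (hz_id ▸ homReach_line hf i z y) (hz_id ▸ homReach_line hf i y z)
    simpa using congrFun hy (y i)
  · push Not at H
    have hconst : ∀ x y, f x = f y := eq_of_update_eq fun x i t => by
      simpa using endo_constant_of_eq _ (isHom_line hf i x) (H i x) t (x i)
    obtain ⟨a, ha⟩ := hsurj 0
    obtain ⟨b, hb⟩ := hsurj 1
    exact absurd (ha.symm.trans ((hconst a b).trans hb)) (by decide)

theorem stmt8 :
    -- (a) G is Słupecki
    IsSlupecki E8 ∧
    -- (b) G is strongly connected
    (∀ x y : Fin 4, Relation.ReflTransGen E8 x y) ∧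
    -- (c) arcs s → id and id → r in Hom(G,G); the identity is not an isolated loop
    (IsHom E8 E8 r8 ∧ IsHom E8 E8 s8 ∧ HomArc E8 E8 s8 id ∧ HomArc E8 E8 id r8 ∧
      ¬ (∀ h : Fin 4 → Fin 4, IsHom E8 E8 h →
          (HomArc E8 E8 h id ∨ HomArc E8 E8 id h) → h = id)) ∧
    -- (d) the connected component of the identity is exactly {id, r, s}, and the
    -- identity is alone in its strong component
    ((∀ h : Fin 4 → Fin 4, IsHom E8 E8 h →
        (HomSymReach E8 E8 id h ↔ (h = id ∨ h = r8 ∨ h = s8))) ∧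
      (∀ h : Fin 4 → Fin 4, IsHom E8 E8 h →
        HomReach E8 E8 id h → HomReach E8 E8 h id → h = id)) := by
  refine ⟨isSlupecki_E8, E8_reach, ⟨isHom_r8, isHom_s8, homArc_s8_id, homArc_id_r8, fun H => ?_⟩,
    fun _ _ => homSymReach_id_iff, fun _ _ => eq_id_of_homReach⟩
  exact absurd (H r8 isHom_r8 (Or.inr homArc_id_r8)) (by decide)
end

section
/- For every m ≥ 3, the reflexive directed m-cycle — the digraph on vertices Z/mZ whose arcs are all loops together with (i, i+1) for each i ∈ Z/mZ — is Słupecki. -/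
/-- The arc relation of the reflexive directed `m`-cycle. -/
abbrev CycleArc (m : ℕ) : ZMod m → ZMod m → Prop := fun i j => i = j ∨ j = i + 1

@[simp]
theorem CycleArc.refl {m : ℕ} (a : ZMod m) : CycleArc m a a := Or.inl rfl

@[simp]
theorem CycleArc.add_one {m : ℕ} (a : ZMod m) : CycleArc m a (a + 1) := Or.inr rfl

/-- A property of tuples that survives changing one coordinate passes to all tuples. -/
theorem forall_of_update {ι V : Type*} [Fintype ι] [DecidableEq ι] {P : (ι → V) → Prop}
    (hP : ∀ x j t, P x → P (Function.update x j t)) {x : ι → V} (hx : P x) (y : ι → V) : P y := by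
  have key : ∀ s : Finset ι, P (s.piecewise y x) := by
    intro s
    induction s using Finset.induction_on with
    | empty => simpa using hx
    | insert j s _ ih =>
      rw [Finset.piecewise_insert]
      exact hP _ _ _ ih
  simpa using key Finset.univ

/-- On a directed cycle, a property preserved by successors holds everywhere once it holds
somewhere. -/
theorem ZMod.forall_of_add_one {m : ℕ} [NeZero m] {P : ZMod m → Prop}
    (hP : ∀ a, P a → P (a + 1)) {a : ZMod m} (ha : P a) (b : ZMod m) : P b := by
  have key : ∀ n : ℕ, P (a + n) := by
    intro n
    induction n with
    | zero => simpa using ha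
    | succ n ih => simpa [add_assoc] using hP _ ih
  simpa using key (b - a).val

/-- Endomorphisms of the reflexive directed cycle are constants and rotations. -/
theorem IsHom.const_or_rotation {m : ℕ} [NeZero m] {h : ZMod m → ZMod m}
    (hh : IsHom (CycleArc m) (CycleArc m) h) :
    (∀ t, h t = h 0) ∨ ∀ t, h t = h 0 + t := by
  classical
  have step : ∀ a, h a = h (a + 1) ∨ h (a + 1) = h a + 1 := fun a => hh a (a + 1) (Or.inr rfl)
  set S : Finset (ZMod m) := Finset.univ.filter fun a => h (a + 1) ≠ h a with hS
  have hsum : ∑ a, (h (a + 1) - h a) = 0 := by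
    rw [Finset.sum_sub_distrib, sub_eq_zero]
    exact Equiv.sum_comp (Equiv.addRight (1 : ZMod m)) h
  have hcard : (S.card : ZMod m) = 0 := by
    rw [← hsum, hS, Finset.card_filter, Nat.cast_sum]
    refine Finset.sum_congr rfl fun a _ => ?_
    rcases step a with ha | ha
    · simp [← ha]
    · by_cases h' : h (a + 1) = h a
      · simp [h']
      · rw [if_pos h', ha]
        simp
  rw [ZMod.natCast_eq_zero_iff] at hcard
  rcases Nat.eq_zero_or_pos S.card with h0 | h0
  · left
    have hall : ∀ a, h (a + 1) = h a := by
      intro a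
      by_contra hne
      have : a ∈ S := by simp [hS, hne]
      simp [Finset.card_eq_zero.mp h0] at this
    exact ZMod.forall_of_add_one (fun a ha => (hall a).trans ha) rfl
  · right
    have huniv : S = Finset.univ := by
      apply Finset.eq_univ_of_card
      rw [ZMod.card]
      exact le_antisymm ((Finset.card_le_univ S).trans_eq (ZMod.card m)) (Nat.le_of_dvd h0 hcard)
    have hall : ∀ a, h (a + 1) = h a + 1 := by
      intro a
      have ha : a ∈ S := huniv ▸ Finset.mem_univ a
      rw [hS, Finset.mem_filter] at ha
      exact (step a).resolve_left fun h' => ha.2 h'.symm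
    refine ZMod.forall_of_add_one (fun a ha => ?_) (a := 0) (by simp)
    rw [hall, ha, add_assoc]

theorem ZMod.two_ne_zero_and_two_ne_one {m : ℕ} (hm : 3 ≤ m) :
    (2 : ZMod m) ≠ 0 ∧ (2 : ZMod m) ≠ 1 := by
  refine ⟨fun h => ?_, fun h => ?_⟩
  · have h' : ((2 : ℕ) : ZMod m) = 0 := by exact_mod_cast h
    rw [ZMod.natCast_eq_zero_iff] at h'
    exact absurd (Nat.le_of_dvd two_pos h') (by omega)
  · have h' : ((1 : ℕ) : ZMod m) = 0 := by
      have : (1 : ZMod m) = 0 := by linear_combination h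
      simpa using this
    rw [ZMod.natCast_eq_zero_iff] at h'
    exact absurd (Nat.le_of_dvd one_pos h') (by omega)

/-- The map `f` acts as a rotation on the line through `x` in direction `i`. -/
def RotatesAlong {m k : ℕ} (f : (Fin k → ZMod m) → ZMod m) (i : Fin k) (x : Fin k → ZMod m) :
    Prop :=
  ∀ t, f (Function.update x i t) = f (Function.update x i 0) + t

section

variable {m k : ℕ} {f : (Fin k → ZMod m) → ZMod m}

theorem RotatesAlong.apply_update {i : Fin k} {x : Fin k → ZMod m} (h : RotatesAlong f i x)
    (t : ZMod m) : f (Function.update x i (x i + t)) = f x + t := by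
  have hx := h (x i)
  rw [Function.update_eq_self] at hx
  rw [h, hx, add_assoc]

theorem IsHom.const_or_rotatesAlong [NeZero m]
    (hf : IsHom (PowE (CycleArc m) k) (CycleArc m) f)
    (i : Fin k) (x : Fin k → ZMod m) :
    (∀ t, f (Function.update x i t) = f x) ∨ RotatesAlong f i x := by
  have hline : IsHom (CycleArc m) (CycleArc m) fun t => f (Function.update x i t) := by
    refine fun s t hst => hf _ _ fun j => ?_
    rcases eq_or_ne j i with rfl | hj
    · simpa using hst
    · simp [hj]
  refine hline.const_or_rotation.imp_left fun h t => ?_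
  have hx := h (x i)
  simp only [Function.update_eq_self] at hx
  rw [h, hx]

/-- Adjacent parallel lines have the same type. -/
theorem RotatesAlong.of_arc (hf : IsHom (PowE (CycleArc m) k) (CycleArc m) f)
    (hm : 3 ≤ m) {i : Fin k} {x y : Fin k → ZMod m}
    (hxy : PowE (CycleArc m) k x y) (hx : RotatesAlong f i x) : RotatesAlong f i y := by
  have : NeZero m := ⟨by omega⟩
  refine (IsHom.const_or_rotatesAlong hf i y).resolve_left fun hy => ?_
  have harc : ∀ t, f (Function.update x i t) = f y ∨ f y = f (Function.update x i t) + 1 := by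
    intro t
    rw [← hy t]
    refine hf _ _ fun j => ?_
    rcases eq_or_ne j i with rfl | hj
    · simp
    · simpa [hj] using hxy j
  obtain ⟨h20, h21⟩ := ZMod.two_ne_zero_and_two_ne_one hm
  have h := harc (f y + 1 - f (Function.update x i 0))
  rw [hx, add_sub_cancel] at h
  rcases h with h | h
  · exact h21 (by linear_combination h)
  · exact h20 (by linear_combination -h)

theorem RotatesAlong.all_parallel (hf : IsHom (PowE (CycleArc m) k) (CycleArc m) f)
    (hm : 3 ≤ m) {i : Fin k} {x : Fin k → ZMod m}
    (hx : RotatesAlong f i x) (y : Fin k → ZMod m) : RotatesAlong f i y := by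
  have : NeZero m := ⟨by omega⟩
  refine forall_of_update (P := RotatesAlong f i) (fun x j t hx => ?_) hx y
  refine ZMod.forall_of_add_one (P := fun t => RotatesAlong f i (Function.update x j t))
    (fun a ha => RotatesAlong.of_arc hf hm (fun l => ?_) ha) (a := x j) (by simpa using hx) t
  rcases eq_or_ne l j with rfl | hl
  · simp
  · simp [hl]

theorem RotatesAlong.unique (hf : IsHom (PowE (CycleArc m) k) (CycleArc m) f)
    (hm : 3 ≤ m) {i j : Fin k} {x y : Fin k → ZMod m}
    (hi : RotatesAlong f i x) (hj : RotatesAlong f j y) : j = i := by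
  by_contra hne
  set z := Function.update x i (x i + 1)
  have hz : z j = x j := by simp [z, hne]
  have h1 : f z = f x + 1 := hi.apply_update 1
  have h2 : f (Function.update z j (z j + 1)) = f z + 1 :=
    (RotatesAlong.all_parallel hf hm hj z).apply_update 1
  have harc : CycleArc m (f x) (f (Function.update z j (z j + 1))) := by
    refine hf _ _ fun l => ?_
    rcases eq_or_ne l j with rfl | hl
    · simp [hz]
    · rcases eq_or_ne l i with rfl | hl'
      · simp [z, hl]
      · simp [z, hl, hl']
  obtain ⟨h20, h21⟩ := ZMod.two_ne_zero_and_two_ne_one hm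
  rw [h2, h1] at harc
  rcases harc with h | h
  · exact h20 (by linear_combination -h)
  · exact h21 (by linear_combination h)

end

theorem stmt10 (m : ℕ) (hm : 3 ≤ m) :
    IsSlupecki (fun i j : ZMod m => i = j ∨ j = i + 1) := by
  intro k _ f hf hsurj
  have : NeZero m := ⟨by omega⟩
  have : Fact (1 < m) := ⟨by omega⟩
  obtain ⟨i, x, hix⟩ : ∃ i x, RotatesAlong f i x := by
    by_contra! hnone
    have hconst : ∀ y, f y = f 0 :=
      forall_of_update (P := fun y => f y = f 0) (x := 0)
        (fun x j t hx =>
          ((IsHom.const_or_rotatesAlong hf j x).resolve_right (hnone j x) t).trans hx) rfl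
    obtain ⟨y, hy⟩ := hsurj (f 0 + 1)
    exact one_ne_zero (left_eq_add.mp ((hconst y).symm.trans hy))
  refine ⟨i, fun t => f 0 + t, ?_, ?_⟩
  · rintro s t (rfl | rfl)
    · exact Or.inl rfl
    · exact Or.inr (add_assoc _ _ _).symm
  · refine forall_of_update (P := fun y => f y = f 0 + y i) (x := 0) (fun y j t hy => ?_) (by simp)
    rcases eq_or_ne j i with rfl | hj
    · have h := (RotatesAlong.all_parallel hf hm hix y).apply_update (t - y j)
      rw [add_sub_cancel] at h
      rw [h, hy, Function.update_self]
      ring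
    · have h := (IsHom.const_or_rotatesAlong hf j y).resolve_right
        fun h => hj (RotatesAlong.unique hf hm hix h)
      rw [h, hy, Function.update_of_ne hj.symm]
end

section
/- For every m ≥ 2, the reflexive symmetric cycle of girth 2m — the digraph on vertices Z/2mZ whose arcs are all loops together with (i, i+1) and (i+1, i) for each i ∈ Z/2mZ — is Słupecki. -/
/-- A map `ℤ^k → ℤ` moving by at most `c` along unit steps of the sup metric is `c`-Lipschitz. -/
theorem abs_sub_le_of_unit_steps {k : ℕ} (c : ℤ) (F : (Fin k → ℤ) → ℤ)
    (hF : ∀ x y, (∀ i, |y i - x i| ≤ 1) → |F y - F x| ≤ c) (N : ℕ) :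
    ∀ x y, (∀ i, |y i - x i| ≤ (N : ℤ)) → |F y - F x| ≤ c * N := by
  induction N with
  | zero =>
    intro x y h
    have : y = x := funext fun i => by
      have := h i
      rw [abs_le] at this
      push_cast at this
      omega
    simp [this]
  | succ N ih =>
    intro x y h
    have h1 := hF (fun i => max (min (x i) (y i + N)) (y i - N)) x fun i => by
      have := h i
      rw [abs_le] at this ⊢
      push_cast at this
      omega
    have h2 := ih (fun i => max (min (x i) (y i + N)) (y i - N)) y fun i => by
      rw [abs_le]
      omega
    rw [abs_le] at h1 h2 ⊢
    push_cast
    constructor <;> linarith [h1.1, h1.2, h2.1, h2.2]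

/-- A map on `ℤ^k` invariant under unit steps of the sup metric is constant. -/
theorem eq_of_unit_steps_invariant {k : ℕ} {α : Type*} (H : (Fin k → ℤ) → α)
    (hH : ∀ x y, (∀ i, |y i - x i| ≤ 1) → H y = H x) (x y : Fin k → ℤ) : H y = H x := by
  classical
  obtain ⟨N, hN⟩ : ∃ N : ℕ, ∀ i, |y i - x i| ≤ (N : ℤ) := by
    refine ⟨∑ j, (y j - x j).natAbs, fun j => ?_⟩
    rw [Int.abs_eq_natAbs]
    exact_mod_cast
      Finset.single_le_sum (f := fun j => (y j - x j).natAbs) (by simp) (Finset.mem_univ j)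
  have := abs_sub_le_of_unit_steps 0 (fun z => if H z = H x then 0 else 1)
    (fun a b h => by simp [hH a b h]) N x y hN
  by_contra hne
  simp [hne] at this

/-- A 1-Lipschitz map `ℤ^k → ℤ` that grows at full speed along the period `n` of coordinate `i` is
a translate of the `i`-th projection. -/
theorem eq_add_apply_of_full_speed {k : ℕ} (F : (Fin k → ℤ) → ℤ)
    (hF : ∀ x y, (∀ i, |y i - x i| ≤ 1) → |F y - F x| ≤ 1) {n : ℕ} (hn : 0 < n) (i : Fin k)
    (hi : ∀ x, F (x + Pi.single i (n : ℤ)) = F x + n) (x : Fin k → ℤ) :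
    F x = F 0 + x i := by
  have hmul : ∀ (N : ℕ) x, F (x + Pi.single i ((N * n : ℕ) : ℤ)) = F x + (N * n : ℕ) := by
    intro N
    induction N with
    | zero => intro x; simp
    | succ N ih =>
      intro x
      have h := hi (x + Pi.single i ((N * n : ℕ) : ℤ))
      rw [ih, add_assoc, ← Pi.single_add] at h
      rw [show (((N + 1) * n : ℕ) : ℤ) = ((N * n : ℕ) : ℤ) + n by push_cast; ring, h]
      ring
  obtain ⟨B, hB⟩ : ∃ B : ℕ, ∀ j, |x j| ≤ B := by
    refine ⟨∑ j, (x j).natAbs, fun j => ?_⟩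
    rw [Int.abs_eq_natAbs]
    exact_mod_cast Finset.single_le_sum (f := fun j => (x j).natAbs) (by simp) (Finset.mem_univ j)
  have hBn : 2 * B ≤ 2 * B * n := Nat.le_mul_of_pos_right _ hn
  generalize hM : 2 * B * n = M at hBn
  have hMF := hmul (2 * B)
  rw [hM] at hMF
  have hxi := abs_le.1 (hB i)
  have up := abs_sub_le_of_unit_steps 1 F hF (x i + M).toNat 0 (x + Pi.single i (M : ℤ))
    fun j => by
      have hj := abs_le.1 (hB j)
      rw [abs_le]
      rcases eq_or_ne j i with rfl | hji
      · simp only [Pi.add_apply, Pi.single_eq_same, Pi.zero_apply]; omega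
      · simp only [Pi.add_apply, Pi.single_eq_of_ne hji, Pi.zero_apply]; omega
  have down := abs_sub_le_of_unit_steps 1 F hF (M - x i).toNat 0 (x - Pi.single i (M : ℤ))
    fun j => by
      have hj := abs_le.1 (hB j)
      rw [abs_le]
      rcases eq_or_ne j i with rfl | hji
      · simp only [Pi.sub_apply, Pi.single_eq_same, Pi.zero_apply]; omega
      · simp only [Pi.sub_apply, Pi.single_eq_of_ne hji, Pi.zero_apply]; omega
  have h1 := hMF x
  have h2 := hMF (x - Pi.single i (M : ℤ))
  rw [sub_add_cancel] at h2
  rw [abs_le] at up down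
  omega

theorem ZMod.valMinAbs_one_of_two_lt {n : ℕ} (hn : 2 < n) : (1 : ZMod n).valMinAbs = 1 :=
  have : NeZero n := ⟨by omega⟩
  (ZMod.valMinAbs_spec _ _).2 ⟨by simp, by constructor <;> omega⟩

theorem ZMod.valMinAbs_neg_one_of_two_lt {n : ℕ} (hn : 2 < n) : (-1 : ZMod n).valMinAbs = -1 :=
  have : NeZero n := ⟨by omega⟩
  (ZMod.valMinAbs_spec _ _).2 ⟨by simp, by constructor <;> omega⟩

/-- In a triangle of the reflexive `n`-cycle, `n ≥ 4`, the signed steps add up. -/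
theorem ZMod.valMinAbs_add_of_cycle_steps {n : ℕ} (hn : 4 ≤ n) {u v : ZMod n}
    (hu : u = 0 ∨ u = 1 ∨ u = -1) (hv : v = 0 ∨ v = 1 ∨ v = -1)
    (huv : u + v = 0 ∨ u + v = 1 ∨ u + v = -1) :
    (u + v).valMinAbs = u.valMinAbs + v.valMinAbs := by
  have key : ∀ a : ℕ, 0 < a → a < n → (a : ZMod n) ≠ 0 := fun a h0 h1 h =>
    absurd (Nat.le_of_dvd h0 ((ZMod.natCast_eq_zero_iff a n).1 h)) (by omega)
  have k1 : (1 : ZMod n) ≠ 0 := by simpa using key 1 (by omega) (by omega)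
  have k2 : (2 : ZMod n) ≠ 0 := by simpa using key 2 (by omega) (by omega)
  have k3 : (3 : ZMod n) ≠ 0 := by simpa using key 3 (by omega) (by omega)
  have p1 := ZMod.valMinAbs_one_of_two_lt (n := n) (by omega)
  have p2 := ZMod.valMinAbs_neg_one_of_two_lt (n := n) (by omega)
  rcases hu with rfl | rfl | rfl <;> rcases hv with rfl | rfl | rfl <;>
    first
    | simp [p1, p2]; done
    | exfalso; rcases huv with h | h | h <;>
        first
        | exact k2 (by linear_combination h)
        | exact k2 (by linear_combination -h)
        | exact k1 (by linear_combination h)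
        | exact k1 (by linear_combination -h)
        | exact k3 (by linear_combination h)
        | exact k3 (by linear_combination -h)

/-- Maps from the grid `ℤ^k` to the reflexive `n`-cycle, `n ≥ 4`, lift to `ℤ`. -/
theorem exists_lift_of_cycle_map {k n : ℕ} (hn : 4 ≤ n) (g : (Fin k → ℤ) → ZMod n)
    (hg : ∀ x y, (∀ i, |y i - x i| ≤ 1) →
      g y - g x = 0 ∨ g y - g x = 1 ∨ g y - g x = -1) :
    ∃ F : (Fin k → ℤ) → ℤ, F 0 = 0 ∧
      (∀ x y, (∀ i, |y i - x i| ≤ 1) → F y - F x = (g y - g x).valMinAbs) := by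
  have tri : ∀ x y z : Fin k → ℤ, (∀ i, |y i - x i| ≤ 1) → (∀ i, |z i - y i| ≤ 1) →
      (∀ i, |z i - x i| ≤ 1) →
      (g z - g x).valMinAbs = (g y - g x).valMinAbs + (g z - g y).valMinAbs := by
    intro x y z h1 h2 h3
    have h : g z - g x = (g y - g x) + (g z - g y) := by ring
    rw [h]
    exact ZMod.valMinAbs_add_of_cycle_steps hn (hg _ _ h1) (hg _ _ h2) (h ▸ hg _ _ h3)
  let cl : ℕ → (Fin k → ℤ) → Fin k → ℤ := fun t x i => max (min (x i) t) (-t)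
  have hcl : ∀ t x i, cl t x i = max (min (x i) t) (-t) := fun _ _ _ => rfl
  let S : ℕ → (Fin k → ℤ) → ℤ := fun N x =>
    ∑ t ∈ Finset.range N, (g (cl (t + 1) x) - g (cl t x)).valMinAbs
  have hS : ∀ N x y, (∀ i, |y i - x i| ≤ 1) →
      S N y - S N x = (g (cl N y) - g (cl N x)).valMinAbs := by
    intro N x y h
    induction N with
    | zero =>
      have : cl 0 y = cl 0 x := funext fun i => by simp only [hcl]; omega
      simp [S, this]
    | succ N ih =>
      have t1 := tri (cl N x) (cl (N + 1) x) (cl (N + 1) y)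
        (fun i => by rw [hcl, hcl, abs_le]; push_cast; omega)
        (fun i => by have := abs_le.1 (h i); rw [hcl, hcl, abs_le]; push_cast; omega)
        (fun i => by have := abs_le.1 (h i); rw [hcl, hcl, abs_le]; push_cast; omega)
      have t2 := tri (cl N x) (cl N y) (cl (N + 1) y)
        (fun i => by have := abs_le.1 (h i); rw [hcl, hcl, abs_le]; omega)
        (fun i => by rw [hcl, hcl, abs_le]; push_cast; omega)
        (fun i => by have := abs_le.1 (h i); rw [hcl, hcl, abs_le]; push_cast; omega)
      simp only [S, Finset.sum_range_succ] at ih ⊢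
      linarith
  have hfix : ∀ (N : ℕ) x, (∀ i, |x i| ≤ (N : ℤ)) → cl N x = x := fun N x h => funext fun i => by
    have := abs_le.1 (h i)
    rw [hcl]; omega
  have hstab : ∀ (N M : ℕ) x, (∀ i, |x i| ≤ (N : ℤ)) → S (N + M) x = S N x := by
    intro N M x h
    induction M with
    | zero => rfl
    | succ M ih =>
      rw [← ih, ← add_assoc]
      simp only [S]
      rw [Finset.sum_range_succ,
        hfix (N + M + 1) x (fun i => (h i).trans (by push_cast; omega)),
        hfix (N + M) x (fun i => (h i).trans (by push_cast; omega))]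
      simp
  let B : (Fin k → ℤ) → ℕ := fun x => ∑ j, (x j).natAbs
  have hB : ∀ x i, |x i| ≤ (B x : ℤ) := fun x j => by
    rw [Int.abs_eq_natAbs]
    exact_mod_cast Finset.single_le_sum (f := fun j => (x j).natAbs) (by simp) (Finset.mem_univ j)
  refine ⟨fun x => S (B x) x, by simp [S, B], fun x y h => ?_⟩
  have hy := hstab (B y) (B x) y (hB y)
  have hx := hstab (B x) (B y) x (hB x)
  have h2 := hS (B x + B y) x y h
  rw [hfix _ y fun i => (hB y i).trans (by push_cast; omega),
    hfix _ x fun i => (hB x i).trans (by push_cast; omega), hx, add_comm (B x), hy] at h2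
  exact h2

/-- A map on `ℤ^k` with period `n` in each coordinate factors through congruence mod `n`. -/
theorem eq_of_coordinate_periods {k n : ℕ} (F : (Fin k → ℤ) → ℤ)
    (hF : ∀ i x, F (x + Pi.single i (n : ℤ)) = F x) {x y : Fin k → ℤ}
    (hxy : ∀ i, (x i : ZMod n) = y i) : F x = F y := by
  let P : AddSubgroup (Fin k → ℤ) :=
    { carrier := {w | ∀ x, F (x + w) = F x}
      add_mem' := fun {a b} ha hb x => by rw [← add_assoc, hb, ha]
      zero_mem' := fun x => by rw [add_zero]
      neg_mem' := fun {a} ha x => by rw [← ha (x + -a), neg_add_cancel_right] }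
  have hmem : y - x ∈ P := by
    rw [← Finset.univ_sum_single (y - x)]
    refine P.sum_mem fun i _ => ?_
    obtain ⟨c, hc⟩ := (ZMod.intCast_eq_intCast_iff_dvd_sub _ _ _).1 (hxy i)
    have : Pi.single i ((y - x) i) = c • (Pi.single i (n : ℤ) : Fin k → ℤ) := by
      rw [← Pi.single_smul, Pi.sub_apply, hc, smul_eq_mul, mul_comm]
    rw [this]
    exact P.zsmul_mem (hF i) c
  have := hmem x
  rwa [add_sub_cancel, eq_comm] at this

theorem stmt11 (m : ℕ) (hm : 2 ≤ m) :
    IsSlupecki (fun i j : ZMod (2 * m) => i = j ∨ j = i + 1 ∨ i = j + 1) := by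
  intro k _ f hf hsurj
  have hn4 : 4 ≤ 2 * m := by omega
  have : NeZero (2 * m) := ⟨by omega⟩
  let π : (Fin k → ℤ) → Fin k → ZMod (2 * m) := fun x i => (x i : ZMod (2 * m))
  have hπ : ∀ X : Fin k → ZMod (2 * m), ∃ x, π x = X := fun X =>
    ⟨fun i => (X i).valMinAbs, funext fun i => ZMod.coe_valMinAbs _⟩
  let g : (Fin k → ℤ) → ZMod (2 * m) := fun x => f (π x)
  have hg : ∀ x y, (∀ i, |y i - x i| ≤ 1) →
      g y - g x = 0 ∨ g y - g x = 1 ∨ g y - g x = -1 := by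
    intro x y h
    have := hf (π x) (π y) fun i => by
      have hi := abs_le.1 (h i)
      rcases (show x i = y i ∨ y i = x i + 1 ∨ x i = y i + 1 by omega) with h | h | h
      · left; simp [π, h]
      · right; left; simp [π, h]
      · right; right; simp [π, h]
    rcases this with h | h | h
    · left; simp [g, h]
    · right; left; simp [g, h]
    · right; right; simp [g, h]
  obtain ⟨F, hF0, hF⟩ := exists_lift_of_cycle_map hn4 g hg
  have hlip : ∀ x y, (∀ i, |y i - x i| ≤ 1) → |F y - F x| ≤ 1 := by
    intro x y h
    rw [hF x y h]
    rcases hg x y h with h | h | h <;> rw [h]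
    · simp
    · rw [ZMod.valMinAbs_one_of_two_lt (by omega)]; simp
    · rw [ZMod.valMinAbs_neg_one_of_two_lt (by omega)]; simp
  have hcast : ∀ x, (F x : ZMod (2 * m)) = g x - g 0 := by
    intro x
    have := eq_of_unit_steps_invariant (fun x => (F x : ZMod (2 * m)) - g x) (fun x y h => by
      have h1 := congrArg (Int.cast : ℤ → ZMod (2 * m)) (hF x y h)
      rw [ZMod.coe_valMinAbs, Int.cast_sub] at h1
      linear_combination h1) 0 x
    simp only [hF0, Int.cast_zero] at this
    linear_combination this
  have hπn : ∀ i x, g (x + Pi.single i ((2 * m : ℕ) : ℤ)) = g x := by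
    intro i x
    refine congrArg f (funext fun j => ?_)
    simp only [π, Pi.add_apply, Int.cast_add, add_eq_left]
    rcases eq_or_ne j i with rfl | h
    · rw [Pi.single_eq_same, Int.cast_natCast, ZMod.natCast_self]
    · rw [Pi.single_eq_of_ne h, Int.cast_zero]
  have hD : ∀ i x, F (x + Pi.single i ((2 * m : ℕ) : ℤ)) - F x =
      F (Pi.single i ((2 * m : ℕ) : ℤ)) := by
    intro i x
    have := eq_of_unit_steps_invariant (fun x => F (x + Pi.single i ((2 * m : ℕ) : ℤ)) - F x) (fun x y h => by
      have h1 := hF x y h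
      have h2 := hF (x + Pi.single i ((2 * m : ℕ) : ℤ)) (y + Pi.single i ((2 * m : ℕ) : ℤ))
        (by simpa using h)
      rw [hπn, hπn] at h2
      linarith) 0 x
    simpa [hF0] using this
  by_cases hall : ∀ i, F (Pi.single i ((2 * m : ℕ) : ℤ)) = 0
  · exfalso
    have hper : ∀ i x, F (x + Pi.single i ((2 * m : ℕ) : ℤ)) = F x := fun i x => by
      linarith [hD i x, hall i]
    have hdiam : ∀ x y, |F y - F x| ≤ m := by
      intro x y
      rw [eq_of_coordinate_periods F hper
        (y := fun i => x i + ((y i - x i : ℤ) : ZMod (2 * m)).valMinAbs) (x := y)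
        (fun i => by simp)]
      have := abs_sub_le_of_unit_steps 1 F hlip m x
        (fun i => x i + ((y i - x i : ℤ) : ZMod (2 * m)).valMinAbs) fun i => by
          have := ZMod.natAbs_valMinAbs_le ((y i - x i : ℤ) : ZMod (2 * m))
          rw [add_sub_cancel_left, Int.abs_eq_natAbs]
          omega
      simpa using this
    have hex : ∀ c, ∃ x, g x = c := fun c => by
      obtain ⟨X, hX⟩ := hsurj c
      obtain ⟨x, hx⟩ := hπ X
      exact ⟨x, by simp only [g, hx, hX]⟩
    choose s hs using hex
    have hinj : Function.Injective fun c => F (s c) := by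
      intro c d hcd
      have := congrArg (Int.cast : ℤ → ZMod (2 * m)) hcd
      rw [hcast, hcast, hs, hs] at this
      exact sub_left_injective this
    obtain ⟨c₀, hc₀⟩ := Finite.exists_min fun c => F (s c)
    have hcard := Finset.card_le_card_of_injOn (s := Finset.univ)
      (t := Finset.Icc (F (s c₀)) (F (s c₀) + m)) (fun c => F (s c))
      (fun c _ => by
        have := abs_le.1 (hdiam (s c₀) (s c))
        simp only [Finset.coe_Icc, Set.mem_Icc]
        exact ⟨hc₀ c, by linarith⟩) hinj.injOn
    rw [Finset.card_univ, ZMod.card, Int.card_Icc] at hcard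
    omega
  · push Not at hall
    obtain ⟨i, hi⟩ := hall
    have hsize : F (Pi.single i ((2 * m : ℕ) : ℤ)) = (2 * m : ℕ) ∨
        -F (Pi.single i ((2 * m : ℕ) : ℤ)) = (2 * m : ℕ) := by
      have hdvd : ((2 * m : ℕ) : ℤ) ∣ F (Pi.single i ((2 * m : ℕ) : ℤ)) := by
        rw [← ZMod.intCast_zmod_eq_zero_iff_dvd, hcast]
        have := hπn i 0
        rw [zero_add] at this
        rw [this, sub_self]
      have hle := abs_sub_le_of_unit_steps 1 F hlip (2 * m) 0 (Pi.single i ((2 * m : ℕ) : ℤ))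
        fun j => by
          rcases eq_or_ne j i with rfl | h
          · simp
          · simp [Pi.single_eq_of_ne h]
      have hge := Int.le_of_dvd (abs_pos.2 hi) ((dvd_abs _ _).2 hdvd)
      rw [hF0, sub_zero, one_mul] at hle
      rcases abs_choice (F (Pi.single i ((2 * m : ℕ) : ℤ))) with h | h <;> omega
    refine ⟨i, ?_⟩
    rcases hsize with h | h
    · have hlin := eq_add_apply_of_full_speed F hlip (n := 2 * m) (by omega) i
        (fun x => by linarith [hD i x])
      refine ⟨fun c => g 0 + c, ?_, fun X => ?_⟩
      · rintro x y (h | h | h)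
        · left; rw [h]
        · right; left; simp only [h]; ring
        · right; right; simp only [h]; ring
      · obtain ⟨x, rfl⟩ := hπ X
        have h1 := hcast x
        rw [hlin, hF0, zero_add] at h1
        change g x = g 0 + (x i : ZMod (2 * m))
        linear_combination -h1
    · have hlin := eq_add_apply_of_full_speed (fun x => -F x)
        (fun x y h => by rw [neg_sub_neg, abs_sub_comm]; exact hlip x y h)
        (n := 2 * m) (by omega) i (fun x => by linarith [hD i x])
      refine ⟨fun c => g 0 - c, ?_, fun X => ?_⟩
      · rintro x y (h | h | h)
        · left; rw [h]
        · right; right; simp only [h]; ring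
        · right; left; simp only [h]; ring
      · obtain ⟨x, rfl⟩ := hπ X
        have h1 := hcast x
        have h2 := hlin x
        rw [hF0, neg_zero, zero_add] at h2
        rw [← neg_neg (F x), h2, Int.cast_neg] at h1
        change g x = g 0 - (x i : ZMod (2 * m))
        linear_combination -h1
end

section
/- For every m ≥ 2, the 2m-crown — the reflexive digraph on vertices {0, 1, …, 2m−1} whose arcs are all loops together with (2i, 2i+1 mod 2m) and (2i, 2i−1 mod 2m) for each 0 ≤ i ≤ m−1 — is Słupecki. -/
namespace Crown

variable {m : ℕ}

/-- The parity of a vertex of the `2m`-crown. -/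
def parity (m : ℕ) : ZMod (2 * m) →+* ZMod 2 := ZMod.castHom (dvd_mul_right 2 m) (ZMod 2)

/-- The arc relation of the `2m`-crown, in terms of parity. -/
def Arc (m : ℕ) (x y : ZMod (2 * m)) : Prop :=
  x = y ∨ parity m x = 0 ∧ (y = x + 1 ∨ y = x - 1)

/-- Equality or adjacency in the underlying cycle. -/
def Near (x y : ZMod (2 * m)) : Prop := y = x ∨ y = x + 1 ∨ y = x - 1

theorem parity_cases (x : ZMod (2 * m)) : parity m x = 0 ∨ parity m x = 1 := by
  generalize parity m x = a
  revert a
  decide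

theorem arc_iff (hm : 2 ≤ m) (x y : ZMod (2 * m)) :
    (x = y ∨ ∃ i : ℕ, i < m ∧ x = ((2 * i : ℕ) : ZMod (2 * m)) ∧ (y = x + 1 ∨ y = x - 1)) ↔
      Arc m x y := by
  have : NeZero (2 * m) := ⟨by omega⟩
  unfold Arc
  refine or_congr Iff.rfl ⟨?_, ?_⟩
  · rintro ⟨i, -, rfl, h⟩
    refine ⟨?_, h⟩
    rw [map_natCast, ZMod.natCast_eq_zero_iff]
    exact dvd_mul_right 2 i
  · rintro ⟨hx, h⟩
    have hv : ((x.val : ℕ) : ZMod (2 * m)) = x := ZMod.natCast_zmod_val x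
    rw [← hv, map_natCast, ZMod.natCast_eq_zero_iff] at hx
    obtain ⟨i, hi⟩ := hx
    have hlt := ZMod.val_lt x
    exact ⟨i, by omega, by rw [← hi, hv], h⟩

theorem Arc.refl (x : ZMod (2 * m)) : Arc m x x := Or.inl rfl

theorem Arc.near {x y : ZMod (2 * m)} (h : Arc m x y) : Near x y := by
  rcases h with h | ⟨-, h⟩
  · exact Or.inl h.symm
  · exact Or.inr h

theorem Near.symm {x y : ZMod (2 * m)} (h : Near x y) : Near y x := by
  rcases h with rfl | rfl | rfl <;> simp [Near]

theorem Arc.parity_of_ne {x y : ZMod (2 * m)} (h : Arc m x y) (hne : x ≠ y) :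
    parity m x = 0 ∧ parity m y = 1 := by
  rcases h with h | ⟨h0, h⟩
  · exact absurd h hne
  · refine ⟨h0, ?_⟩
    rcases h with rfl | rfl
    · rw [map_add, h0, map_one, zero_add]
    · rw [map_sub, h0, map_one]; decide

theorem Arc.eq_of_parity_one {x y : ZMod (2 * m)} (h : Arc m x y) (hx : parity m x = 1) :
    x = y := by
  by_contra hne
  have := (h.parity_of_ne hne).1
  rw [hx] at this
  exact one_ne_zero this

theorem Arc.eq_of_parity_zero {x y : ZMod (2 * m)} (h : Arc m x y) (hy : parity m y = 0) :
    x = y := by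
  by_contra hne
  have := (h.parity_of_ne hne).2
  rw [hy] at this
  exact zero_ne_one this

theorem arc_add_one {x : ZMod (2 * m)} (h : parity m x = 0) : Arc m x (x + 1) :=
  Or.inr ⟨h, Or.inl rfl⟩

theorem arc_sub_one {x : ZMod (2 * m)} (h : parity m x = 0) : Arc m x (x - 1) :=
  Or.inr ⟨h, Or.inr rfl⟩

theorem parity_add_one {x : ZMod (2 * m)} (h : parity m x = 1) : parity m (x + 1) = 0 := by
  rw [map_add, h, map_one]; decide

theorem parity_sub_one {x : ZMod (2 * m)} (h : parity m x = 1) : parity m (x - 1) = 0 := by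
  rw [map_sub, h, map_one]; decide

theorem add_one_arc {x : ZMod (2 * m)} (h : parity m x = 1) : Arc m (x + 1) x :=
  Or.inr ⟨parity_add_one h, Or.inr (by ring)⟩

theorem sub_one_arc {x : ZMod (2 * m)} (h : parity m x = 1) : Arc m (x - 1) x :=
  Or.inr ⟨parity_sub_one h, Or.inl (by ring)⟩

theorem arc_or_arc_add_one (x : ZMod (2 * m)) : Arc m x (x + 1) ∨ Arc m (x + 1) x :=
  (parity_cases x).imp arc_add_one add_one_arc

theorem eq_of_cast_eq (hm : 2 ≤ m) {a b : ℤ} (hab : |a - b| ≤ 3)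
    (h : (a : ZMod (2 * m)) = b) : a = b := by
  rw [ZMod.intCast_eq_intCast_iff_dvd_sub] at h
  have : b - a = 0 := by
    apply Int.eq_zero_of_abs_lt_dvd h
    rw [abs_sub_comm]
    push_cast
    omega
  omega

theorem abs_sub_le_one (hm : 2 ≤ m) {a b : ℤ} (hab : |a - b| ≤ 2)
    (h : Near (a : ZMod (2 * m)) b) : |a - b| ≤ 1 := by
  rw [abs_le] at hab
  rcases h with h | h | h
  · have := eq_of_cast_eq hm (a := b) (b := a) (by rw [abs_le]; omega) h
    rw [abs_le]; omega
  · have := eq_of_cast_eq hm (a := b) (b := a + 1) (by rw [abs_le]; omega) (by push_cast; exact h)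
    rw [abs_le]; omega
  · have := eq_of_cast_eq hm (a := b) (b := a - 1) (by rw [abs_le]; omega) (by push_cast; exact h)
    rw [abs_le]; omega

theorem abs_sub_le_one_trans (hm : 2 ≤ m) {a b c : ℤ} (hab : |a - b| ≤ 1) (hbc : |b - c| ≤ 1)
    (h : Near (a : ZMod (2 * m)) c) : |a - c| ≤ 1 :=
  abs_sub_le_one hm ((abs_sub_le a b c).trans (by omega)) h

theorem val_add_one (hm : 2 ≤ m) {u : ZMod (2 * m)} (h : u + 1 ≠ 0) :
    (u + 1).val = u.val + 1 := by
  have : NeZero (2 * m) := ⟨by omega⟩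
  have : Fact (1 < 2 * m) := ⟨by omega⟩
  have hlt := ZMod.val_lt u
  apply ZMod.val_add_of_lt _ |>.trans (by rw [ZMod.val_one])
  rw [ZMod.val_one]
  by_contra hge
  apply h
  have e : u.val + 1 = 2 * m := by omega
  have := congrArg (Nat.cast : ℕ → ZMod (2 * m)) e
  rwa [Nat.cast_add, ZMod.natCast_zmod_val, Nat.cast_one, ZMod.natCast_self] at this

/-- A lift of `f` to the integers changing by at most one along each edge. -/
def IsLift {P : Type*} (R : P → P → Prop) (f : P → ZMod (2 * m)) (F : P → ℤ) : Prop :=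
  (∀ p, (F p : ZMod (2 * m)) = f p) ∧ ∀ p q, R p q → |F p - F q| ≤ 1

theorem exists_lift_of_not_surjective (hm : 2 ≤ m) {P : Type*} {R : P → P → Prop}
    {f : P → ZMod (2 * m)} (hf : IsHom R (Arc m) f) (hs : ¬ Function.Surjective f) :
    ∃ F : P → ℤ, IsLift R f F := by
  have : NeZero (2 * m) := ⟨by omega⟩
  obtain ⟨v, hv⟩ := not_forall.mp hs
  have hv' : ∀ p, f p - v ≠ 0 := fun p h => hv ⟨p, sub_eq_zero.mp h⟩
  refine ⟨fun p => ((f p - v).val : ℤ) + (v.val : ℤ), fun p => ?_, fun p q hpq => ?_⟩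
  · push_cast
    rw [ZMod.natCast_zmod_val, ZMod.natCast_zmod_val, sub_add_cancel]
  · rcases (hf p q hpq).near with h | h | h
    · simp [h]
    · have e : f q - v = (f p - v) + 1 := by rw [h]; ring
      have := val_add_one hm (e ▸ hv' q)
      rw [← e] at this
      rw [abs_le]; push_cast [this]; constructor <;> linarith
    · have e : f p - v = (f q - v) + 1 := by rw [h]; ring
      have := val_add_one hm (e ▸ hv' p)
      rw [← e] at this
      rw [abs_le]; push_cast [this]; constructor <;> linarith

theorem induction_add_one (hm : 2 ≤ m) {Q : ZMod (2 * m) → Prop} (a : ZMod (2 * m)) (ha : Q a)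
    (hs : ∀ c, Q c → Q (c + 1)) (b : ZMod (2 * m)) : Q b := by
  have : NeZero (2 * m) := ⟨by omega⟩
  have key : ∀ n : ℕ, Q (a + n) := by
    intro n
    induction n with
    | zero => simpa using ha
    | succ n ih => rw [Nat.cast_succ, ← add_assoc]; exact hs _ ih
  have := key (b - a).val
  rwa [ZMod.natCast_zmod_val, add_sub_cancel] at this

theorem powE_cons {k : ℕ} {a b : ZMod (2 * m)} {s t : Fin k → ZMod (2 * m)} (h : Arc m a b)
    (hst : PowE (Arc m) k s t) :
    PowE (Arc m) (k + 1) (Fin.cons a s : Fin (k + 1) → ZMod (2 * m)) (Fin.cons b t) := by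
  intro i
  refine Fin.cases ?_ (fun j => ?_) i
  · simpa using h
  · simpa using hst j

theorem powE_refl {k : ℕ} (s : Fin k → ZMod (2 * m)) : PowE (Arc m) k s s := fun _ => Arc.refl _

theorem exists_lift (hm : 2 ≤ m) {k : ℕ} {f : (Fin k → ZMod (2 * m)) → ZMod (2 * m)}
    (hf : IsHom (PowE (Arc m) k) (Arc m) f)
    (hline : ∀ i z, ¬ Function.Surjective fun c => f (Function.update z i c)) :
    ∃ F : (Fin k → ZMod (2 * m)) → ℤ, IsLift (PowE (Arc m) k) f F := by
  have : NeZero (2 * m) := ⟨by omega⟩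
  induction k with
  | zero =>
    refine ⟨fun _ => ((f default).val : ℤ), fun p => ?_, fun p q _ => by simp⟩
    rw [Int.cast_natCast, ZMod.natCast_zmod_val, Subsingleton.elim p default]
  | succ k ih =>
    obtain ⟨F₀, hF₀, hF₀'⟩ := ih (f := fun s => f (Fin.cons 0 s))
      (fun s t hst => hf _ _ (powE_cons (Arc.refl 0) hst))
      (fun i z => by
        have := hline i.succ (Fin.cons 0 z)
        simpa only [Fin.cons_update] using this)
    have hH : ∀ s : Fin k → ZMod (2 * m), ∃ H : ZMod (2 * m) → ℤ,
        IsLift (Arc m) (fun c => f (Fin.cons c s)) H := by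
      intro s
      refine exists_lift_of_not_surjective hm
        (fun a b hab => hf _ _ (powE_cons hab (powE_refl s))) ?_
      have := hline 0 (Fin.cons 0 s)
      simpa only [Fin.update_cons_zero] using this
    choose H hH hH' using hH
    obtain ⟨G, hG⟩ : ∃ G : ZMod (2 * m) → (Fin k → ZMod (2 * m)) → ℤ,
        ∀ c s, G c s = F₀ s + H s c - H s 0 := ⟨_, fun _ _ => rfl⟩
    have hGf : ∀ c s, (G c s : ZMod (2 * m)) = f (Fin.cons c s) := by
      intro c s
      rw [hG]
      push_cast
      rw [hF₀, hH, hH]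
      ring
    have hcol : ∀ a b s, Arc m a b → |G a s - G b s| ≤ 1 := by
      intro a b s hab
      have := hH' s a b hab
      rw [hG, hG]
      convert this using 2
      ring
    have hnear : ∀ {a b s t}, Arc m a b → PowE (Arc m) k s t →
        Near (G a s : ZMod (2 * m)) (G b t) := by
      intro a b s t hab hst
      rw [hGf, hGf]
      exact (hf _ _ (powE_cons hab hst)).near
    have hrow : ∀ s t, PowE (Arc m) k s t → ∀ c, |G c s - G c t| ≤ 1 := by
      intro s t hst c
      refine induction_add_one hm (Q := fun c => |G c s - G c t| ≤ 1) 0 ?_ (fun c hc => ?_) c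
      · simpa [hG] using hF₀' s t hst
      · rcases arc_or_arc_add_one c with h | h
        · have h1 := abs_sub_le_one_trans hm hc (hcol _ _ t h) (hnear h hst)
          refine abs_sub_le_one_trans hm ?_ h1 (hnear (Arc.refl _) hst)
          rw [abs_sub_comm]
          exact hcol _ _ s h
        · have h1 := abs_sub_le_one_trans hm (hcol _ _ s h) hc (hnear h hst)
          refine abs_sub_le_one_trans hm h1 ?_ (hnear (Arc.refl _) hst)
          rw [abs_sub_comm]
          exact hcol _ _ t h
    refine ⟨fun x => G (x 0) (Fin.tail x), fun x => ?_, fun x y hxy => ?_⟩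
    · rw [hGf, Fin.cons_self_tail]
    · have ht : PowE (Arc m) k (Fin.tail x) (Fin.tail y) := fun i => hxy i.succ
      exact abs_sub_le_one_trans hm (hrow _ _ ht _) (hcol _ _ _ (hxy 0)) (hnear (hxy 0) ht)

theorem walk_bound {k : ℕ} {F : (Fin k → ZMod (2 * m)) → ℤ}
    (hF : ∀ p q, PowE (Arc m) k p q → |F p - F q| ≤ 1) (n : ℕ)
    (x : Fin k → ZMod (2 * m)) (hx : ∀ i, parity m (x i) = 0) (e : Fin k → ℤ)
    (he : ∀ i, |e i| ≤ n ∧ (2 : ℤ) ∣ e i - n) :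
    |F x - F (fun i => x i + e i)| ≤ n := by
  induction n generalizing e with
  | zero =>
    have : (fun i => x i + (e i : ZMod (2 * m))) = x := by
      funext i
      have : e i = 0 := by simpa using (he i).1
      simp [this]
    simp [this]
  | succ n ih =>
    have hstep : ∀ i, ∃ a : ℤ, (|a| ≤ n ∧ (2 : ℤ) ∣ a - n) ∧ (e i = a + 1 ∨ e i = a - 1) := by
      intro i
      obtain ⟨h1, h2⟩ := he i
      rw [abs_le] at h1
      push_cast at h1 h2
      by_cases hp : 0 < e i
      · exact ⟨e i - 1, ⟨by rw [abs_le]; omega, by omega⟩, by omega⟩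
      · exact ⟨e i + 1, ⟨by rw [abs_le]; omega, by omega⟩, by omega⟩
    choose a ha hae using hstep
    have hpar : ∀ i, parity m (x i + a i) = n := by
      intro i
      rw [map_add, hx, map_intCast, zero_add, ← Int.cast_natCast (R := ZMod 2), eq_comm,
        ZMod.intCast_eq_intCast_iff_dvd_sub]
      exact (ha i).2
    have hlast : |F (fun i => x i + a i) - F (fun i => x i + e i)| ≤ 1 := by
      have hcast : ∀ i, x i + (e i : ZMod (2 * m)) = x i + a i + 1 ∨
          x i + (e i : ZMod (2 * m)) = x i + a i - 1 := by
        intro i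
        rcases hae i with h | h <;> rw [h] <;> push_cast
        · left; ring
        · right; ring
      have hn : (n : ZMod 2) = 0 ∨ (n : ZMod 2) = 1 := by
        generalize (n : ZMod 2) = b
        revert b
        decide
      rcases hn with hn | hn
      · exact hF _ _ fun i => Or.inr ⟨(hpar i).trans hn, hcast i⟩
      · rw [abs_sub_comm]
        refine hF _ _ fun i => ?_
        rcases hcast i with h | h
        · rw [h]; exact add_one_arc ((hpar i).trans hn)
        · rw [h]; exact sub_one_arc ((hpar i).trans hn)
    refine (abs_sub_le _ (F fun i => x i + a i) _).trans ?_
    push_cast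
    exact add_le_add (ih a ha) hlast

theorem abs_sub_le_of_parity (hm : 2 ≤ m) {k : ℕ} {F : (Fin k → ZMod (2 * m)) → ℤ}
    (hF : ∀ p q, PowE (Arc m) k p q → |F p - F q| ≤ 1) {x y : Fin k → ZMod (2 * m)}
    (hx : ∀ i, parity m (x i) = 0) (hy : ∀ i, parity m (y i) = 1) : |F x - F y| ≤ m := by
  have : NeZero (2 * m) := ⟨by omega⟩
  obtain ⟨n, hnm, hn, hnm'⟩ : ∃ n : ℕ, n ≤ m ∧ n % 2 = 1 ∧ m ≤ n + 1 := by
    rcases Nat.mod_two_eq_zero_or_one m with h | h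
    · exact ⟨m - 1, by omega, by omega, by omega⟩
    · exact ⟨m, le_rfl, h, by omega⟩
  have h := walk_bound hF n x hx (fun i => (y i - x i).valMinAbs) (fun i => by
    have h1 := ZMod.natAbs_valMinAbs_le (y i - x i)
    have h2 : ((y i - x i).valMinAbs : ZMod 2) = 1 := by
      rw [← map_intCast (parity m), ZMod.coe_valMinAbs, map_sub, hx, hy, sub_zero]
    have h3 : (2 : ℤ) ∣ 1 - (y i - x i).valMinAbs := by
      have := (ZMod.intCast_eq_intCast_iff_dvd_sub (y i - x i).valMinAbs 1 2).mp (by simpa using h2)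
      exact_mod_cast this
    generalize (y i - x i).valMinAbs = v at *
    rw [abs_le]
    omega)
  simp only [ZMod.coe_valMinAbs, add_sub_cancel] at h
  exact h.trans (by exact_mod_cast hnm)

theorem not_surjective_of_lift (hm : 2 ≤ m) {k : ℕ}
    {f : (Fin k → ZMod (2 * m)) → ZMod (2 * m)} (hf : IsHom (PowE (Arc m) k) (Arc m) f)
    {F : (Fin k → ZMod (2 * m)) → ℤ} (hF : IsLift (PowE (Arc m) k) f F) :
    ¬ Function.Surjective f := by
  have : NeZero (2 * m) := ⟨by omega⟩
  intro hs
  obtain ⟨hlift, hF⟩ := hF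
  have down : ∀ p : Fin k → ZMod (2 * m), ∃ q : Fin k → ZMod (2 * m),
      (∀ i, parity m (q i) = 0) ∧ PowE (Arc m) k q p := by
    intro p
    have : ∀ i, ∃ c, parity m c = 0 ∧ Arc m c (p i) := fun i =>
      (parity_cases (p i)).elim (fun h => ⟨p i, h, Arc.refl _⟩)
        (fun h => ⟨p i + 1, parity_add_one h, add_one_arc h⟩)
    choose q h1 h2 using this
    exact ⟨q, h1, h2⟩
  have up : ∀ p : Fin k → ZMod (2 * m), ∃ q : Fin k → ZMod (2 * m),
      (∀ i, parity m (q i) = 1) ∧ PowE (Arc m) k p q := by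
    intro p
    have : ∀ i, ∃ c, parity m c = 1 ∧ Arc m (p i) c := fun i =>
      (parity_cases (p i)).elim
        (fun h => ⟨p i + 1, by rw [map_add, h, map_one, zero_add], arc_add_one h⟩)
        (fun h => ⟨p i, h, Arc.refl _⟩)
    choose q h1 h2 using this
    exact ⟨q, h1, h2⟩
  have eq_of : ∀ p q, |F p - F q| ≤ 1 → f p = f q → F p = F q := fun p q h h' =>
    eq_of_cast_eq hm (h.trans (by norm_num)) (by rw [hlift, hlift, h'])
  have pure_rep : ∀ p, ∃ q, F q = F p ∧
      (parity m (f p) = 0 ∧ (∀ i, parity m (q i) = 0) ∨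
        parity m (f p) = 1 ∧ (∀ i, parity m (q i) = 1)) := by
    intro p
    rcases parity_cases (f p) with h | h
    · obtain ⟨q, hq, hqp⟩ := down p
      exact ⟨q, eq_of _ _ (hF _ _ hqp) ((hf _ _ hqp).eq_of_parity_zero h), Or.inl ⟨h, hq⟩⟩
    · obtain ⟨q, hq, hpq⟩ := up p
      exact ⟨q, (eq_of _ _ (hF _ _ hpq) ((hf _ _ hpq).eq_of_parity_one h)).symm, Or.inr ⟨h, hq⟩⟩
  obtain ⟨p, hp⟩ := Finite.exists_min F
  obtain ⟨q, hq⟩ := Finite.exists_max F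
  have hrange : F p + (2 * m - 1) ≤ F q := by
    by_contra! hlt
    have hsub : Finset.univ ⊆ (Finset.Icc (F p) (F q)).image (Int.cast : ℤ → ZMod (2 * m)) := by
      intro c _
      obtain ⟨x, rfl⟩ := hs c
      exact Finset.mem_image.mpr ⟨F x, Finset.mem_Icc.mpr ⟨hp x, hq x⟩, hlift x⟩
    have h1 := (Finset.card_le_card hsub).trans Finset.card_image_le
    rw [Finset.card_univ, ZMod.card, Int.card_Icc] at h1
    omega
  have hcong : parity m (f p) = parity m (f q) → (2 : ℤ) ∣ F q - F p := by
    intro h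
    rw [← hlift, ← hlift, map_intCast, map_intCast, ZMod.intCast_eq_intCast_iff_dvd_sub] at h
    exact_mod_cast h
  obtain ⟨x, hx, hx'⟩ := pure_rep p
  obtain ⟨y, hy, hy'⟩ := pure_rep q
  rcases hx' with ⟨a, hx'⟩ | ⟨a, hx'⟩ <;> rcases hy' with ⟨b, hy'⟩ | ⟨b, hy'⟩
  · obtain ⟨z, hz, hyz⟩ := up y
    have h1 := abs_le.mp (hF _ _ hyz)
    have h2 := abs_le.mp (abs_sub_le_of_parity hm hF hx' hz)
    have h3 := hcong (a.trans b.symm)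
    omega
  · have h2 := abs_le.mp (abs_sub_le_of_parity hm hF hx' hy')
    omega
  · have h2 := abs_le.mp (abs_sub_le_of_parity hm hF hy' hx')
    omega
  · obtain ⟨z, hz, hzy⟩ := down y
    have h1 := abs_le.mp (hF _ _ hzy)
    have h2 := abs_le.mp (abs_sub_le_of_parity hm hF hz hx')
    have h3 := hcong (a.trans b.symm)
    omega

theorem add_one_ne_sub_one (hm : 2 ≤ m) (c : ZMod (2 * m)) : c + 1 ≠ c - 1 := by
  intro h
  have h2 : ((1 : ℤ) : ZMod (2 * m)) = ((-1 : ℤ) : ZMod (2 * m)) := by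
    push_cast
    rw [sub_eq_add_neg] at h
    exact add_left_cancel h
  have := eq_of_cast_eq hm (by norm_num) h2
  omega

theorem parity_map (hm : 2 ≤ m) {g : ZMod (2 * m) → ZMod (2 * m)} (hg : IsHom (Arc m) (Arc m) g)
    (hi : Function.Injective g) (c : ZMod (2 * m)) : parity m (g c) = parity m c := by
  have : Fact (1 < 2 * m) := ⟨by omega⟩
  have hne : c ≠ c + 1 := by simp
  rcases parity_cases c with h | h
  · rw [h]
    exact ((hg _ _ (arc_add_one h)).parity_of_ne (hi.ne hne)).1
  · rw [h]
    exact ((hg _ _ (add_one_arc h)).parity_of_ne (hi.ne hne.symm)).2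

theorem eq_of_arc_of_injective (hm : 2 ≤ m) {g g' : ZMod (2 * m) → ZMod (2 * m)}
    (hg : IsHom (Arc m) (Arc m) g) (hi : Function.Injective g) (hg' : IsHom (Arc m) (Arc m) g')
    (h : (∀ c, Arc m (g c) (g' c)) ∨ ∀ c, Arc m (g' c) (g c)) : g' = g := by
  have hpar := parity_map hm hg hi
  rcases h with h | h
  · have hodd : ∀ c, parity m c = 1 → g c = g' c := fun c hc =>
      (h c).eq_of_parity_one ((hpar c).trans hc)
    funext c
    rcases parity_cases c with hc | hc
    · by_contra hne
      have h1 := ((h c).parity_of_ne (Ne.symm hne)).2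
      have e1 := (hg' _ _ (arc_add_one hc)).eq_of_parity_one h1
      have e2 := (hg' _ _ (arc_sub_one hc)).eq_of_parity_one h1
      rw [← hodd (c + 1) (by rw [map_add, hc, map_one, zero_add])] at e1
      rw [← hodd (c - 1) (by rw [map_sub, hc, map_one]; decide)] at e2
      exact add_one_ne_sub_one hm c (hi (e1.symm.trans e2))
    · exact (hodd c hc).symm
  · have heven : ∀ c, parity m c = 0 → g' c = g c := fun c hc =>
      (h c).eq_of_parity_zero ((hpar c).trans hc)
    funext c
    rcases parity_cases c with hc | hc
    · exact heven c hc
    · by_contra hne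
      have h1 := ((h c).parity_of_ne hne).1
      have e1 := (hg' _ _ (add_one_arc hc)).eq_of_parity_zero h1
      have e2 := (hg' _ _ (sub_one_arc hc)).eq_of_parity_zero h1
      rw [heven _ (parity_add_one hc)] at e1
      rw [heven _ (parity_sub_one hc)] at e2
      exact add_one_ne_sub_one hm c (hi (e1.trans e2.symm))

theorem powE_update {k : ℕ} {x y : Fin k → ZMod (2 * m)} (hxy : PowE (Arc m) k x y) (i : Fin k)
    {a b : ZMod (2 * m)} (hab : Arc m a b) :
    PowE (Arc m) k (Function.update x i a) (Function.update y i b) := by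
  intro j
  by_cases h : j = i
  · subst h; simpa using hab
  · simpa [h] using hxy j

theorem essUnary_of_line (hm : 2 ≤ m) {k : ℕ} {f : (Fin k → ZMod (2 * m)) → ZMod (2 * m)}
    (hf : IsHom (PowE (Arc m) k) (Arc m) f) (i : Fin k) (z : Fin k → ZMod (2 * m))
    (hs : Function.Surjective fun c => f (Function.update z i c)) : EssUnary (Arc m) f := by
  have : NeZero (2 * m) := ⟨by omega⟩
  have hline : ∀ w, IsHom (Arc m) (Arc m) fun c => f (Function.update w i c) :=
    fun w a b hab => hf _ _ (powE_update (powE_refl w) i hab)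
  obtain ⟨g, hg⟩ : ∃ g, g = fun c => f (Function.update z i c) := ⟨_, rfl⟩
  have hhom : IsHom (Arc m) (Arc m) g := hg ▸ hline z
  have hi : Function.Injective g := Finite.injective_iff_surjective.mpr (hg ▸ hs)
  have hmove : ∀ w j, (fun c => f (Function.update w i c)) = g →
      ∀ a, (fun c => f (Function.update (Function.update w j a) i c)) = g := by
    intro w j hw a
    refine induction_add_one hm
      (Q := fun a => (fun c => f (Function.update (Function.update w j a) i c)) = g) (w j)
      (by rwa [Function.update_eq_self]) (fun a ha => ?_) a
    refine eq_of_arc_of_injective hm hhom hi (hline _) ?_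
    refine (arc_or_arc_add_one a).imp (fun h c => ?_) (fun h c => ?_)
    · rw [← ha]
      exact hf _ _ (powE_update (powE_update (powE_refl w) j h) i (Arc.refl c))
    · rw [← ha]
      exact hf _ _ (powE_update (powE_update (powE_refl w) j h) i (Arc.refl c))
  have hall : ∀ w, (fun c => f (Function.update w i c)) = g := by
    intro w
    have : ∀ s : Finset (Fin k), (fun c => f (Function.update (s.piecewise w z) i c)) = g := by
      intro s
      induction s using Finset.induction_on with
      | empty => rw [Finset.piecewise_empty, hg]
      | insert j s _ ih =>
        rw [Finset.piecewise_insert]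
        exact hmove _ j ih _
    simpa using this Finset.univ
  refine ⟨i, g, hhom, fun x => ?_⟩
  simp [← hall x]

theorem isSlupecki (hm : 2 ≤ m) : IsSlupecki (Arc m) := by
  intro k _ f hf hs
  by_contra hne
  obtain ⟨F, hF⟩ := exists_lift hm hf fun i z h => hne (essUnary_of_line hm hf i z h)
  exact not_surjective_of_lift hm hf hF hs

end Crown

theorem stmt12 (m : ℕ) (hm : 2 ≤ m) :
    IsSlupecki (fun x y : ZMod (2 * m) =>
      x = y ∨ ∃ i : ℕ, i < m ∧ x = ((2 * i : ℕ) : ZMod (2 * m)) ∧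
        (y = x + 1 ∨ y = x - 1)) := by
  have h := Crown.isSlupecki hm
  have e : (fun x y : ZMod (2 * m) =>
      x = y ∨ ∃ i : ℕ, i < m ∧ x = ((2 * i : ℕ) : ZMod (2 * m)) ∧
        (y = x + 1 ∨ y = x - 1)) = Crown.Arc m := by
    funext x y
    exact propext (Crown.arc_iff hm x y)
  rw [e]
  exact h
end

section
/- Let G be the reflexive digraph on vertices {0,1,2,3} whose arcs are all loops together with (0,1), (1,2), (2,1), (2,3), (3,0), (0,3). Then G is Słupecki. -/
/-- A property of tuples that survives every change of a single coordinate and holds for one tuple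
holds for all of them. -/
theorem forall_of_forall_update {ι α : Type*} [Fintype ι] [DecidableEq ι] {P : (ι → α) → Prop}
    (step : ∀ a j t, P a → P (Function.update a j t)) {a : ι → α} (ha : P a) (b : ι → α) :
    P b := by
  have key : ∀ s : Finset ι, P (s.piecewise b a) := by
    intro s
    induction s using Finset.induction_on with
    | empty => simpa using ha
    | insert j s _ ih =>
      rw [Finset.piecewise_insert]
      exact step _ _ _ ih
  simpa using key Finset.univ

/-- The arc relation of the reflexive digraph `0 → 1 ↔ 2 → 3 ↔ 0`. -/
def SquareArc (x y : Fin 4) : Prop :=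
  x = y ∨ y = x + 1 ∨ (x = 2 ∧ y = 1) ∨ (x = 0 ∧ y = 3)

instance (x y : Fin 4) : Decidable (SquareArc x y) := by
  unfold SquareArc
  infer_instance

theorem squareArc_self (x : Fin 4) : SquareArc x x := Or.inl rfl

theorem squareArc_add_one (x : Fin 4) : SquareArc x (x + 1) := Or.inr (Or.inl rfl)

theorem squareArc_iff (x y : Fin 4) :
    (x = y ∨ (x, y) ∈ ({(0,1), (1,2), (2,1), (2,3), (3,0), (0,3)} : Set (Fin 4 × Fin 4))) ↔
      SquareArc x y := by
  simp only [Set.mem_insert_iff, Set.mem_singleton_iff, Prod.mk.injEq]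
  revert x y
  decide

/-- The block of a vertex with respect to the partition into the symmetric edges `{1, 2}` and
`{3, 0}`. -/
def squareBlock (x : Fin 4) : Bool := x = 1 ∨ x = 2

/-- An endomorphism that meets both blocks is the identity or the rotation by two. -/
theorem squareArc_endo_eq {u : Fin 4 → Fin 4} (hu : IsHom SquareArc SquareArc u)
    {s t : Fin 4} (hst : squareBlock (u s) ≠ squareBlock (u t)) :
    ∃ c : Fin 4, (c = 0 ∨ c = 2) ∧ ∀ x, u x = x + c := by
  have h01 := hu 0 1 (by decide)
  have h12 := hu 1 2 (by decide)
  have h21 := hu 2 1 (by decide)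
  have h23 := hu 2 3 (by decide)
  have h30 := hu 3 0 (by decide)
  have h03 := hu 0 3 (by decide)
  have hne : ¬ (squareBlock (u 0) = squareBlock (u 1) ∧ squareBlock (u 1) = squareBlock (u 2) ∧
      squareBlock (u 2) = squareBlock (u 3)) := by
    rintro ⟨h1, h2, h3⟩
    apply hst
    fin_cases s <;> fin_cases t <;> simp_all
  simp only [Fin.forall_fin_succ (n := 3), Fin.forall_fin_succ (n := 2),
    Fin.forall_fin_succ (n := 1), Fin.forall_fin_succ (n := 0), IsEmpty.forall_iff, and_true]
  change ∃ c : Fin 4, (c = 0 ∨ c = 2) ∧ u 0 = 0 + c ∧ u 1 = 1 + c ∧ u 2 = 2 + c ∧ u 3 = 3 + c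
  generalize u 0 = p at *
  generalize u 1 = q at *
  generalize u 2 = r at *
  generalize u 3 = w at *
  clear hst hu
  revert p q r w
  decide

/-- The identity and the rotation by two have no other out-neighbours among the endomorphisms. -/
theorem squareArc_endo_rigid {c : Fin 4} (hc : c = 0 ∨ c = 2) {h : Fin 4 → Fin 4}
    (hh : IsHom SquareArc SquareArc h) (hch : HomArc SquareArc SquareArc (fun x => x + c) h)
    (x : Fin 4) : h x = x + c := by
  have h1 := hch (x + 3) x (by simpa [add_assoc] using squareArc_add_one (x + 3))
  have h2 := hch x x (squareArc_self x)
  have h3 := hh x (x + 1) (squareArc_add_one x)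
  have h4 := hch x (x + 1) (squareArc_add_one x)
  have h5 := hch (x + 1) (x + 1) (squareArc_self _)
  have h6 := fun hx => hch (x + 2) (x + 1) hx
  have h7 := fun hx => hch (x + 1) x hx
  generalize h x = p at *
  generalize h (x + 1) = q at *
  clear hh hch
  beta_reduce at *
  revert x p q c
  decide

theorem isSlupecki_squareArc : IsSlupecki SquareArc := by
  intro k _ f hf hsurj
  have restrict_arc : ∀ (a b : Fin k → Fin 4) (i : Fin k), PowE SquareArc k a b →
      HomArc SquareArc SquareArc (fun t => f (Function.update a i t))
        (fun t => f (Function.update b i t)) := by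
    intro a b i hab x y hxy
    apply hf
    intro l
    rcases eq_or_ne l i with rfl | hl
    · simpa using hxy
    · simpa only [Function.update_of_ne hl] using hab l
  have restrict_hom : ∀ (a : Fin k → Fin 4) (i : Fin k),
      IsHom SquareArc SquareArc (fun t => f (Function.update a i t)) :=
    fun a i => restrict_arc a a i fun _ => squareArc_self _
  obtain ⟨a, i, t, hat⟩ : ∃ a i t, squareBlock (f (Function.update a i t)) ≠
      squareBlock (f a) := by
    by_contra! hcon
    obtain ⟨x, hx⟩ := hsurj 0
    obtain ⟨y, hy⟩ := hsurj 1
    have := forall_of_forall_update (P := fun b => squareBlock (f b) = squareBlock (f x))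
      (fun b j t hb => (hcon b j t).trans hb) rfl y
    rw [hx, hy] at this
    exact absurd this (by decide)
  obtain ⟨c, hc, hac⟩ := squareArc_endo_eq (restrict_hom a i) (s := t) (t := a i)
    (by simpa using hat)
  have succ_step : ∀ (b : Fin k → Fin 4) (j : Fin k),
      (∀ t, f (Function.update b i t) = t + c) →
      ∀ t, f (Function.update (Function.update b j (b j + 1)) i t) = t + c := by
    intro b j hb
    have harc := restrict_arc b (Function.update b j (b j + 1)) i (by
      intro l
      rcases eq_or_ne l j with rfl | hl
      · simpa using squareArc_add_one (b l)
      · simpa [Function.update_of_ne hl] using squareArc_self (b l))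
    simp only [hb] at harc
    exact squareArc_endo_rigid hc (restrict_hom _ i) harc
  have step : ∀ (b : Fin k → Fin 4) (j : Fin k) (s : Fin 4),
      (∀ t, f (Function.update b i t) = t + c) →
      ∀ t, f (Function.update (Function.update b j s) i t) = t + c := by
    intro b j s hb
    have h1 := succ_step b j hb
    have h2 := succ_step _ j h1
    have h3 := succ_step _ j h2
    simp only [Function.update_self, Function.update_idem] at h2 h3
    have hs : ∀ p s : Fin 4, s = p ∨ s = p + 1 ∨ s = p + 1 + 1 ∨ s = p + 1 + 1 + 1 := by decide
    rcases hs (b j) s with rfl | rfl | rfl | rfl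
    · simpa using hb
    · exact h1
    · exact h2
    · exact h3
  refine ⟨i, fun x => x + c, ?_, fun x => ?_⟩
  · have := restrict_hom a i
    simpa only [hac] using this
  · simpa using forall_of_forall_update
      (P := fun b => ∀ t, f (Function.update b i t) = t + c) step hac x (x i)

theorem stmt13 :
    IsSlupecki (fun x y : Fin 4 =>
      x = y ∨ (x, y) ∈ ({(0,1), (1,2), (2,1), (2,3), (3,0), (0,3)} :
        Set (Fin 4 × Fin 4))) := by
  simp only [squareArc_iff]
  exact isSlupecki_squareArc
end

section
/- For every n ≥ 2, let G_n be the reflexive symmetric digraph on vertices Z/2nZ in which two distinct vertices i and j are joined by arcs in both directions if and only if j ≠ i + n (the complete graph on 2n vertices with the perfect matching of antipodal pairs removed, plus all loops). Then G_n is Słupecki. -/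
/-- A function on a finite power that never changes when a single coordinate changes is constant. -/
theorem eq_of_forall_update_eq {ι α β : Type*} [Finite ι] [DecidableEq ι] {f : (ι → α) → β}
    (h : ∀ x i c, f (Function.update x i c) = f x) (x y : ι → α) : f y = f x := by
  have := Fintype.ofFinite ι
  have key : ∀ s : Finset ι, f (s.piecewise y x) = f x := by
    intro s
    induction s using Finset.induction_on with
    | empty => simp
    | insert j s _ ih => rw [Finset.piecewise_insert, h, ih]
  simpa using key Finset.univ

/-- Jablonskii's lemma on three values: a surjective operation onto a set with at least three
elements that depends on more than one coordinate takes three distinct values at three points no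
coordinate of which separates all three. -/
theorem exists_three_values {ι α β : Type*} [Finite ι] [DecidableEq ι] [Nonempty β]
    {f : (ι → α) → β} (h3 : ∀ u v : β, ∃ w, w ≠ u ∧ w ≠ v) (hf : Function.Surjective f)
    (hu : ∀ (i : ι) (g : α → β), ∃ x, f x ≠ g (x i)) :
    ∃ p q r, f p ≠ f q ∧ f p ≠ f r ∧ f q ≠ f r ∧ ∀ j, p j = q j ∨ p j = r j := by
  obtain ⟨x, i, c, hc⟩ : ∃ x i c, f (Function.update x i c) ≠ f x := by
    by_contra! h
    obtain ⟨x, -⟩ := hf (Classical.arbitrary β)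
    obtain ⟨w, hw, -⟩ := h3 (f x) (f x)
    obtain ⟨y, rfl⟩ := hf w
    exact hw (eq_of_forall_update_eq h x y)
  obtain ⟨y, hy, e, he, he'⟩ : ∃ y, f (Function.update x i (y i)) ≠ f y ∧
      ∃ e, f (Function.update x i (y i)) ≠ f (Function.update x i e) ∧
        f y ≠ f (Function.update x i e) := by
    by_cases hs : Function.Surjective fun a => f (Function.update x i a)
    · obtain ⟨y, hy⟩ := hu i fun a => f (Function.update x i a)
      obtain ⟨w, hw, hw'⟩ := h3 (f y) (f (Function.update x i (y i)))
      obtain ⟨e, rfl⟩ := hs w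
      exact ⟨y, hy.symm, e, hw'.symm, hw.symm⟩
    · simp only [Function.Surjective, not_forall, not_exists] at hs
      obtain ⟨v, hv⟩ := hs
      obtain ⟨y, rfl⟩ := hf v
      refine ⟨y, hv _, ?_⟩
      by_cases hx : f (Function.update x i (y i)) = f x
      · exact ⟨c, hx.trans_ne hc.symm, Ne.symm (hv c)⟩
      · refine ⟨x i, ?_, Ne.symm (hv _)⟩
        rwa [Function.update_eq_self]
  refine ⟨Function.update x i (y i), y, Function.update x i e, hy, he, he', fun j => ?_⟩
  by_cases hj : j = i
  · subst hj
    simp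
  · simp [hj]

/-- Jablonskii's lemma: if a surjective operation on a finite set with at least three elements
depends on more than one coordinate, then it already takes all values on a product of proper
subsets. -/
theorem exists_forall_exists_ne {ι α : Type*} [Finite ι] [Finite α] [Nonempty α]
    {f : (ι → α) → α} (h3 : ∀ u v : α, ∃ w, w ≠ u ∧ w ≠ v) (hf : Function.Surjective f)
    (hu : ∀ (i : ι) (g : α → α), ∃ x, f x ≠ g (x i)) :
    ∃ a : ι → α, ∀ v, ∃ x, f x = v ∧ ∀ i, x i ≠ a i := by
  classical
  obtain ⟨p, q, r, hpq, hpr, hqr, hj⟩ := exists_three_values h3 hf hu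
  obtain ⟨s, hs, hp, hq, hr⟩ : ∃ s : α → ι → α,
      (∀ v, f (s v) = v) ∧ s (f p) = p ∧ s (f q) = q ∧ s (f r) = r := by
    refine ⟨fun v => if v = f p then p else if v = f q then q else if v = f r then r else
      Function.surjInv hf v, fun v => ?_, ?_, ?_, ?_⟩
    · dsimp only
      split_ifs with h₁ h₂ h₃
      exacts [h₁.symm, h₂.symm, h₃.symm, Function.surjInv_eq hf v]
    · simp
    · simp [hpq.symm]
    · simp [hpr.symm, hqr.symm]
  have hns : ∀ i, ∃ a, ∀ v, s v i ≠ a := by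
    intro i
    by_contra! h
    have hinj : Function.Injective fun v => s v i := Finite.injective_iff_surjective.mpr h
    rcases hj i with h | h
    · exact hpq (hinj (by simpa only [hp, hq] using h))
    · exact hpr (hinj (by simpa only [hp, hr] using h))
  choose a ha using hns
  exact ⟨a, fun v => ⟨s v, hs v, fun i => ha i v⟩⟩

theorem stmt14 (n : ℕ) (hn : 2 ≤ n) :
    IsSlupecki (fun i j : ZMod (2 * n) =>
      i = j ∨ (i ≠ j ∧ j ≠ i + (n : ZMod (2 * n)))) := by
  intro k _ f hom hf
  have : NeZero (2 * n) := ⟨by omega⟩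
  have hnn : (n : ZMod (2 * n)) + n = 0 := by
    have h := ZMod.natCast_self (2 * n)
    rwa [Nat.cast_mul, Nat.cast_two, two_mul (n : ZMod (2 * n))] at h
  have hn0 : (n : ZMod (2 * n)) ≠ 0 := by
    rw [Ne, ZMod.natCast_eq_zero_iff]
    intro h
    have := Nat.le_of_dvd (by omega) h
    omega
  have h3 : ∀ u v : ZMod (2 * n), ∃ w, w ≠ u ∧ w ≠ v := by
    intro u v
    obtain ⟨w, hw⟩ := Finset.exists_mem_notMem_of_card_lt_card
      (s := {u, v}) (t := (Finset.univ : Finset (ZMod (2 * n)))) (by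
        rw [Finset.card_univ, ZMod.card]
        exact Finset.card_le_two.trans_lt (by omega))
    exact ⟨w, by simpa using hw⟩
  by_cases hu : ∃ (i : Fin k) (g : ZMod (2 * n) → ZMod (2 * n)), ∀ x, f x = g (x i)
  · obtain ⟨i, g, hg⟩ := hu
    refine ⟨i, g, fun c d hcd => ?_, hg⟩
    have h := hom (fun _ => c) (fun _ => d) fun _ => hcd
    simpa only [hg] using h
  · push Not at hu
    obtain ⟨a, ha⟩ := exists_forall_exists_ne h3 hf hu
    obtain ⟨x, hx, hxa⟩ := ha (f (fun i => a i + n) + n)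
    have h := hom (fun i => a i + n) x fun i => by
      change _ ∨ _ ≠ _ ∧ x i ≠ a i + n + n
      rw [add_assoc, hnn, add_zero]
      exact (em _).imp_right fun h => ⟨h, hxa i⟩
    rw [hx] at h
    rcases h with h | h
    · exact (hn0 (by simpa using h)).elim
    · exact (h.2 rfl).elim
end

section
/- For all integers m, n ≥ 2, the poset m ⊕ n (the ordinal sum of an m-element antichain below an n-element antichain), regarded as a reflexive digraph via its order relation, is Słupecki. -/
/-- The ordinal sum `m ⊕ n`: an `m`-element antichain below an `n`-element antichain,
viewed as a reflexive digraph via its order relation. -/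
def ordSum2 (m n : ℕ) : (Fin m ⊕ Fin n) → (Fin m ⊕ Fin n) → Prop
  | Sum.inl a, Sum.inl a' => a = a'
  | Sum.inl _, Sum.inr _ => True
  | Sum.inr _, Sum.inl _ => False
  | Sum.inr b, Sum.inr b' => b = b'

/-- `f` is monotone for the order in which `a < b` means `L a` and `U b`. -/
def TwoLevelMono {V ι : Type*} (L U : V → Prop) (f : (ι → V) → V) : Prop :=
  ∀ x y, (∀ i, x i = y i ∨ L (x i) ∧ U (y i)) → f x = f y ∨ L (f x) ∧ U (f y)

/-- On tuples with all entries in `L`, the value of `f` is determined by coordinate `i`. -/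
def DependsOnlyOn {V ι : Type*} (L : V → Prop) (f : (ι → V) → V) (i : ι) : Prop :=
  ∀ x y, (∀ j, L (x j)) → (∀ j, L (y j)) → x i = y i → f x = f y

namespace TwoLevelMono

variable {V ι : Type*} {L U : V → Prop} {f : (ι → V) → V}

theorem swap (h : TwoLevelMono L U f) : TwoLevelMono U L f := by
  intro x y hxy
  have := h y x fun i => (hxy i).imp Eq.symm And.symm
  exact this.imp Eq.symm And.symm

theorem exists_lower_preimage (h : TwoLevelMono L U f) (hLU : ∀ v, L v ∨ U v)
    (hdisj : ∀ v, L v → ¬ U v) (hf : Function.Surjective f) {a : V} (ha : L a) :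
    ∃ x, (∀ i, L (x i)) ∧ f x = a := by
  classical
  obtain ⟨z, rfl⟩ := hf a
  refine ⟨fun i => if L (z i) then z i else f z,
    fun i => by dsimp only; split_ifs <;> assumption, ?_⟩
  refine (h _ z fun i => ?_).resolve_right fun h' => hdisj _ ha h'.2
  by_cases hi : L (z i)
  · simp [hi]
  · simpa [hi] using Or.inr ⟨ha, (hLU _).resolve_left hi⟩

/-- If `f` takes distinct values at two tuples `y ≥ z` and `y' ≥ z`, then it agrees at `z` with
its values below `z`. -/
theorem eq_of_le_of_ne (h : TwoLevelMono L U f) (hdisj : ∀ v, L v → ¬ U v) {x z y y' : ι → V}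
    (hxz : ∀ i, x i = z i ∨ L (x i) ∧ U (z i)) (hzy : ∀ i, z i = y i ∨ L (z i) ∧ U (y i))
    (hzy' : ∀ i, z i = y' i ∨ L (z i) ∧ U (y' i)) (hne : f y ≠ f y') : f x = f z := by
  have hz : L (f z) := by
    rcases h z y hzy with h1 | h1
    · rcases h z y' hzy' with h2 | h2
      · exact absurd (h1.symm.trans h2) hne
      · exact h2.1
    · exact h1.1
  exact (h x z hxz).resolve_right fun h' => hdisj _ hz h'.2

theorem dependsOnlyOn (h : TwoLevelMono L U f) (hdisj : ∀ v, L v → ¬ U v) {i : ι}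
    {y y' : ι → V} (hy : ∀ j, U (y j)) (hy' : ∀ j, U (y' j)) (heq : ∀ j, j ≠ i → y j = y' j)
    (hne : f y ≠ f y') : DependsOnlyOn L f i := by
  classical
  have key : ∀ x, (∀ j, L (x j)) → f x = f (Function.update y i (x i)) := by
    intro x hx
    refine h.eq_of_le_of_ne hdisj (y := y) (y' := y') (fun j => ?_) (fun j => ?_) (fun j => ?_) hne
      <;> rcases eq_or_ne j i with rfl | hj
    · simp
    · simp [hj, hx, hy]
    · simp [hx, hy]
    · simp [hj]
    · simp [hx, hy']
    · simp [hj, heq j hj]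
  intro x x' hx hx' hxx'
  rw [key x hx, key x' hx', hxx']

theorem eq_const (h : TwoLevelMono L U f) (hLU : ∀ v, L v ∨ U v) (hdisj : ∀ v, L v → ¬ U v)
    {i : ι} (hL : DependsOnlyOn L f i) (hU : DependsOnlyOn U f i) {y y' : ι → V}
    (hy : ∀ j, U (y j)) (hy' : ∀ j, U (y' j)) (hne : f y ≠ f y') {z : ι → V} (hz : L (z i)) :
    f z = f fun _ => z i := by
  classical
  have raise : ∀ y : ι → V, (∀ j, U (y j)) → ∀ j, U (if L (z j) then y i else z j) := by
    intro y hy j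
    split_ifs with hj
    · exact hy i
    · exact (hLU _).resolve_left hj
  have raise_le : ∀ y : ι → V, (∀ j, U (y j)) → ∀ j,
      z j = (if L (z j) then y i else z j) ∨ L (z j) ∧ U (if L (z j) then y i else z j) := by
    intro y hy j
    by_cases hj : L (z j) <;> simp [hj, hy]
  have raise_eq : ∀ y : ι → V, (∀ j, U (y j)) → f (fun j => if L (z j) then y i else z j) = f y :=
    fun y hy => hU _ _ (raise y hy) hy (by simp [hz])
  have hlow : f (fun j => if L (z j) then z j else z i) = f z := by
    refine h.eq_of_le_of_ne hdisj (fun j => ?_) (raise_le y hy) (raise_le y' hy')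
      (by rwa [raise_eq y hy, raise_eq y' hy'])
    by_cases hj : L (z j)
    · simp [hj]
    · simpa [hj] using Or.inr ⟨hz, (hLU _).resolve_left hj⟩
  rw [← hlow]
  refine hL _ _ (fun j => ?_) (fun _ => hz) (by simp)
  split_ifs <;> assumption

end TwoLevelMono

theorem exists_ne_of_single_change {V ι : Type*} [Fintype ι] {U : V → Prop} {f : (ι → V) → V}
    {y y' : ι → V} (hy : ∀ j, U (y j)) (hy' : ∀ j, U (y' j)) (hne : f y ≠ f y') :
    ∃ (i : ι) (w w' : ι → V), (∀ j, U (w j)) ∧ (∀ j, U (w' j)) ∧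
      (∀ j, j ≠ i → w j = w' j) ∧ f w ≠ f w' := by
  classical
  by_contra! hcon
  have key : ∀ s : Finset ι, f (s.piecewise y' y) = f y := by
    intro s
    have hU : ∀ s : Finset ι, ∀ j, U (s.piecewise y' y j) := fun s j => by
      by_cases hj : j ∈ s <;> simp [hj, hy, hy']
    induction s using Finset.induction_on with
    | empty => simp
    | insert i s _ ih =>
      rw [← ih]
      refine hcon i _ _ (hU _) (hU _) fun j hj => ?_
      rw [Finset.piecewise_insert, Function.update_of_ne hj]
  exact hne (by simpa using (key Finset.univ).symm)

theorem TwoLevelMono.exists_eq_const {V ι : Type*} [Fintype ι] {L U : V → Prop}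
    {f : (ι → V) → V} (h : TwoLevelMono L U f) (hLU : ∀ v, L v ∨ U v)
    (hdisj : ∀ v, L v → ¬ U v) (hf : Function.Surjective f)
    (hL : ∃ a a', L a ∧ L a' ∧ a ≠ a') (hU : ∃ b b', U b ∧ U b' ∧ b ≠ b') :
    ∃ i, ∀ z, f z = f fun _ => z i := by
  classical
  have hUL : ∀ v, U v ∨ L v := fun v => (hLU v).symm
  have hdisj' : ∀ v, U v → ¬ L v := fun v hv hv' => hdisj v hv' hv
  obtain ⟨a, a', ha, ha', haa⟩ := hL
  obtain ⟨b, b', hb, hb', hbb⟩ := hU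
  obtain ⟨x, hx, rfl⟩ := h.exists_lower_preimage hLU hdisj hf ha
  obtain ⟨x', hx', rfl⟩ := h.exists_lower_preimage hLU hdisj hf ha'
  obtain ⟨y, hy, rfl⟩ := h.swap.exists_lower_preimage hUL hdisj' hf hb
  obtain ⟨y', hy', rfl⟩ := h.swap.exists_lower_preimage hUL hdisj' hf hb'
  obtain ⟨i, w, w', hw, hw', hww, hne⟩ := exists_ne_of_single_change hy hy' hbb
  have hLi : DependsOnlyOn L f i := h.dependsOnlyOn hdisj hw hw' hww hne
  have hu : ∀ j, L (Function.update x i (x' i) j) := fun j => by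
    rcases eq_or_ne j i with rfl | hj <;> simp [*]
  have hUi : DependsOnlyOn U f i := by
    refine h.swap.dependsOnlyOn hdisj' hx hu (fun j hj => by simp [hj]) ?_
    rwa [hLi _ x' hu hx' (by simp)]
  refine ⟨i, fun z => ?_⟩
  rcases hLU (z i) with hz | hz
  · exact h.eq_const hLU hdisj hLi hUi hy hy' hbb hz
  · exact h.swap.eq_const hUL hdisj' hUi hLi hx hx' haa hz

theorem ordSum2_iff {m n : ℕ} (x y : Fin m ⊕ Fin n) :
    ordSum2 m n x y ↔ x = y ∨ x.isLeft = true ∧ y.isRight = true := by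
  rcases x with x | x <;> rcases y with y | y <;> simp [ordSum2]

theorem stmt16 (m n : ℕ) (hm : 2 ≤ m) (hn : 2 ≤ n) :
    IsSlupecki (ordSum2 m n) := by
  intro k _ f hf hsurj
  have hmono : TwoLevelMono (fun v => v.isLeft = true) (fun v => v.isRight = true) f :=
    fun x y hxy => (ordSum2_iff _ _).1 (hf x y fun i => (ordSum2_iff _ _).2 (hxy i))
  obtain ⟨i, hi⟩ := hmono.exists_eq_const (by simp) (by simp) hsurj
    ⟨.inl ⟨0, by omega⟩, .inl ⟨1, by omega⟩, by simp⟩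
    ⟨.inr ⟨0, by omega⟩, .inr ⟨1, by omega⟩, by simp⟩
  exact ⟨i, fun v => f fun _ => v, fun x y hxy => hf _ _ fun _ => hxy, hi⟩
end

section
/- For all integers m, n, k ≥ 2, the poset m ⊕ n ⊕ k, regarded as a reflexive digraph via its order relation, is not 3-Słupecki: it admits a surjective ternary monotone polymorphism that is not essentially unary. In particular, m ⊕ n ⊕ k is not Słupecki. -/
/-- The ordinal sum `m ⊕ n ⊕ k`: three stacked antichains of sizes `m`, `n`, `k`,
viewed as a reflexive digraph via its order relation. -/
def ordSum3 (m n k : ℕ) :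
    (Fin m ⊕ Fin n ⊕ Fin k) → (Fin m ⊕ Fin n ⊕ Fin k) → Prop
  | Sum.inl a, Sum.inl a' => a = a'
  | Sum.inl _, Sum.inr _ => True
  | Sum.inr _, Sum.inl _ => False
  | Sum.inr (Sum.inl b), Sum.inr (Sum.inl b') => b = b'
  | Sum.inr (Sum.inl _), Sum.inr (Sum.inr _) => True
  | Sum.inr (Sum.inr _), Sum.inr (Sum.inl _) => False
  | Sum.inr (Sum.inr c), Sum.inr (Sum.inr c') => c = c'

/-- A ternary operation on `m ⊕ n ⊕ k`. With `p j = (a, j, c)` for `j` in the middle layer, it is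
the first projection on the tuples that lie in the bottom layer or strictly below some `p j`, the
third projection on those that lie in the top layer or strictly above some `p j`, sends `p j` to
`j`, and is constantly `b` elsewhere. -/
def layerwiseOp {m n k : ℕ} (a : Fin m) (b : Fin n) (c : Fin k) :
    (Fin m ⊕ Fin n ⊕ Fin k) → (Fin m ⊕ Fin n ⊕ Fin k) → (Fin m ⊕ Fin n ⊕ Fin k) →
      Fin m ⊕ Fin n ⊕ Fin k
  | .inl x, .inl _, .inl _ => .inl x
  | .inl x, .inl _, .inr (.inl _) => if x = a then .inl x else .inr (.inl b)
  | .inl x, .inl _, .inr (.inr z) => if x = a ∧ z = c then .inl x else .inr (.inl b)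
  | .inl x, .inr (.inl y), .inr (.inr z) => .inr (.inl (if x = a ∧ z = c then y else b))
  | .inl x, .inr (.inl _), _ => if x = a then .inl x else .inr (.inl b)
  | .inl x, .inr (.inr _), .inr (.inr z) =>
    if x = a ∧ z = c then .inr (.inr z) else .inr (.inl b)
  | .inr (.inr _), .inr (.inr _), .inr (.inr z) => .inr (.inr z)
  | .inr _, .inr _, .inr (.inr z) => if z = c then .inr (.inr z) else .inr (.inl b)
  | _, _, _ => .inr (.inl b)

theorem layerwiseOp_mono {m n k : ℕ} (a : Fin m) (b : Fin n) (c : Fin k)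
    {x y z x' y' z' : Fin m ⊕ Fin n ⊕ Fin k} (hx : ordSum3 m n k x x')
    (hy : ordSum3 m n k y y') (hz : ordSum3 m n k z z') :
    ordSum3 m n k (layerwiseOp a b c x y z) (layerwiseOp a b c x' y' z') := by
  rcases x with x | x | x <;> rcases x' with x' | x' | x' <;>
    first
    | exact hx.elim
    | (rcases y with y | y | y <;> rcases y' with y' | y' | y' <;>
        first
        | exact hy.elim
        | (rcases z with z | z | z <;> rcases z' with z' | z' | z' <;>
            first
            | exact hz.elim
            | (simp only [ordSum3] at hx hy hz
               simp only [layerwiseOp]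
               (try split_ifs) <;> simp_all [ordSum3])))

theorem stmt17 (m n k : ℕ) (hm : 2 ≤ m) (hn : 2 ≤ n) (hk : 2 ≤ k) :
    (∃ f : (Fin 3 → (Fin m ⊕ Fin n ⊕ Fin k)) → (Fin m ⊕ Fin n ⊕ Fin k),
      IsHom (PowE (ordSum3 m n k) 3) (ordSum3 m n k) f ∧
      Function.Surjective f ∧ ¬ EssUnary (ordSum3 m n k) f) ∧
    ¬ IsSlupecki (ordSum3 m n k) := by
  suffices h : ∃ f : (Fin 3 → (Fin m ⊕ Fin n ⊕ Fin k)) → (Fin m ⊕ Fin n ⊕ Fin k),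
      IsHom (PowE (ordSum3 m n k) 3) (ordSum3 m n k) f ∧
      Function.Surjective f ∧ ¬ EssUnary (ordSum3 m n k) f by
    refine ⟨h, fun hS => ?_⟩
    obtain ⟨f, hf, hsurj, hess⟩ := h
    exact hess (hS 3 (by norm_num) f hf hsurj)
  let a : Fin m := ⟨0, by omega⟩
  let a' : Fin m := ⟨1, by omega⟩
  let b : Fin n := ⟨0, by omega⟩
  let c : Fin k := ⟨0, by omega⟩
  let c' : Fin k := ⟨1, by omega⟩
  refine ⟨fun x => layerwiseOp a b c (x 0) (x 1) (x 2),
    fun x y h => layerwiseOp_mono a b c (h 0) (h 1) (h 2), ?_, ?_⟩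
  · rintro (x | y | z)
    · exact ⟨fun _ => .inl x, rfl⟩
    · exact ⟨![.inl a, .inr (.inl y), .inr (.inr c)], by simp [layerwiseOp]⟩
    · exact ⟨fun _ => .inr (.inr z), rfl⟩
  · rintro ⟨i, g, -, hg⟩
    have ha := (hg ![.inl a, .inl a, .inl a]).symm
    have ha' := (hg ![.inl a', .inl a, .inl a]).symm
    have hc := (hg ![.inr (.inr c), .inr (.inr c), .inr (.inr c)]).symm
    have hc' := (hg ![.inr (.inr c), .inr (.inr c), .inr (.inr c')]).symm
    fin_cases i <;> simp_all [layerwiseOp, a, a', c, c']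
end

section
/- Let m, n, k ≥ 2 with n > 2, let P = m ⊕ n ⊕ k with middle antichain B, and let f : P² → P be a monotone map such that f(B²) ⊆ B and f(B²) has at least 2 elements. Then there exist distinct b, b' ∈ B and order-automorphisms τ₀, τ₁ of P such that: (1) τ₀(x) = x and τ₁(x) = x for every x in the bottom antichain A and the top antichain C; and (2) τ₀(f(τ₁(s), s)) = s for s ∈ {b, b'}. -/
theorem exists_perm_map_pair {α : Type*} [DecidableEq α] {a b c d : α} (hab : a ≠ b)
    (hcd : c ≠ d) : ∃ σ : Equiv.Perm α, σ a = c ∧ σ b = d := by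
  have hbc : c ≠ Equiv.swap a c b := fun h =>
    hab ((Equiv.swap a c).injective ((Equiv.swap_apply_left a c).trans h))
  refine ⟨(Equiv.swap a c).trans (Equiv.swap (Equiv.swap a c b) d), ?_, ?_⟩
  · simp [Equiv.swap_apply_of_ne_of_ne hbc hcd]
  · simp

/-- A nonconstant binary function on a set with at least three elements takes different values
at two points differing in both coordinates. -/
theorem exists_ne_ne_map_ne {n : ℕ} (hn : 2 < n) {β : Type*} (g : Fin n → Fin n → β)
    {b₁ b₂ b₃ b₄ : Fin n} (h : g b₁ b₂ ≠ g b₃ b₄) :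
    ∃ x y x' y', x ≠ x' ∧ y ≠ y' ∧ g x y ≠ g x' y' := by
  by_contra! H
  have third (a b : Fin n) : ∃ c, a ≠ c ∧ b ≠ c := by
    obtain ⟨c, hc⟩ : ∃ c, c ∉ ({a, b} : Finset (Fin n)) := by
      by_contra! hc
      have := Finset.card_le_two (a := a) (b := b)
      rw [Finset.eq_univ_iff_forall.2 hc, Finset.card_univ, Fintype.card_fin] at this
      omega
    simp only [Finset.mem_insert, Finset.mem_singleton, not_or] at hc
    exact ⟨c, Ne.symm hc.1, Ne.symm hc.2⟩
  obtain ⟨x, hx₁, hx₃⟩ := third b₁ b₃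
  obtain ⟨y, hy₂, hy₄⟩ := third b₂ b₄
  exact h ((H _ _ _ _ hx₁ hy₂).trans (H _ _ _ _ hx₃ hy₄).symm)

/-- The map on `m ⊕ n ⊕ k` permuting the middle antichain and fixing the other two. -/
def permMiddle (m k : ℕ) {n : ℕ} (σ : Equiv.Perm (Fin n)) :
    Equiv.Perm (Fin m ⊕ Fin n ⊕ Fin k) :=
  Equiv.sumCongr (Equiv.refl _) (Equiv.sumCongr σ (Equiv.refl _))

theorem ordSum3_permMiddle_iff {m n k : ℕ} (σ : Equiv.Perm (Fin n))
    (x y : Fin m ⊕ Fin n ⊕ Fin k) :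
    ordSum3 m n k x y ↔ ordSum3 m n k (permMiddle m k σ x) (permMiddle m k σ y) := by
  rcases x with a | b | c <;> rcases y with a' | b' | c' <;> simp [permMiddle, ordSum3]


theorem stmt18 (m n k : ℕ) (hm : 2 ≤ m) (hn : 2 ≤ n) (hk : 2 ≤ k) (hn2 : 2 < n)
    (f : (Fin m ⊕ Fin n ⊕ Fin k) → (Fin m ⊕ Fin n ⊕ Fin k) → (Fin m ⊕ Fin n ⊕ Fin k))
    (hmono : ∀ x x' y y', ordSum3 m n k x x' → ordSum3 m n k y y' →
      ordSum3 m n k (f x y) (f x' y'))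
    -- f(B²) ⊆ B
    (hB : ∀ b b' : Fin n, ∃ c : Fin n,
      f (Sum.inr (Sum.inl b)) (Sum.inr (Sum.inl b')) = Sum.inr (Sum.inl c))
    -- f(B²) has at least two elements
    (hB2 : ∃ b₁ b₂ b₃ b₄ : Fin n,
      f (Sum.inr (Sum.inl b₁)) (Sum.inr (Sum.inl b₂)) ≠
        f (Sum.inr (Sum.inl b₃)) (Sum.inr (Sum.inl b₄))) :
    ∃ b b' : Fin n, b ≠ b' ∧
      ∃ τ₀ τ₁ : (Fin m ⊕ Fin n ⊕ Fin k) → (Fin m ⊕ Fin n ⊕ Fin k),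
        Function.Bijective τ₀ ∧ Function.Bijective τ₁ ∧
        (∀ x y, ordSum3 m n k x y ↔ ordSum3 m n k (τ₀ x) (τ₀ y)) ∧
        (∀ x y, ordSum3 m n k x y ↔ ordSum3 m n k (τ₁ x) (τ₁ y)) ∧
        (∀ a : Fin m, τ₀ (Sum.inl a) = Sum.inl a ∧ τ₁ (Sum.inl a) = Sum.inl a) ∧
        (∀ c : Fin k, τ₀ (Sum.inr (Sum.inr c)) = Sum.inr (Sum.inr c) ∧
          τ₁ (Sum.inr (Sum.inr c)) = Sum.inr (Sum.inr c)) ∧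
        (∀ s : Fin n, (s = b ∨ s = b') →
          τ₀ (f (τ₁ (Sum.inr (Sum.inl s))) (Sum.inr (Sum.inl s))) =
            Sum.inr (Sum.inl s)) := by
  choose g hg using hB
  obtain ⟨b₁, b₂, b₃, b₄, h⟩ := hB2
  obtain ⟨x, y, x', y', hx, hy, hxy⟩ :=
    exists_ne_ne_map_ne hn2 g (fun e => h (by rw [hg, hg, e]) : g b₁ b₂ ≠ g b₃ b₄)
  obtain ⟨σ₀, h₀, h₀'⟩ := exists_perm_map_pair hxy hy
  obtain ⟨σ₁, h₁, h₁'⟩ := exists_perm_map_pair hy hx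
  refine ⟨y, y', hy, permMiddle m k σ₀, permMiddle m k σ₁, Equiv.bijective _,
    Equiv.bijective _, ordSum3_permMiddle_iff σ₀, ordSum3_permMiddle_iff σ₁,
    fun _ => ⟨rfl, rfl⟩, fun _ => ⟨rfl, rfl⟩, ?_⟩
  rintro s (rfl | rfl)
  · simp [permMiddle, h₁, hg, h₀]
  · simp [permMiddle, h₁', hg, h₀']
end
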